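/- arXiv:1610.04710 — 13 statements merged into one kernel-verified Lean document; each statement's English description precedes it below -/
import Mathlib

section
/- Let f, g : ℕ → ℝ be sequences with Σ_k f_k² = ∞ (i.e. (f_k²) is not summable). For n ∈ ℕ set Γ_n(f) = Σ_{k<n} f_k², ⟨f,g⟩_n = Σ_{k<n} f_k g_k, Γ_n(f,g) = Γ_n(f)·Γ_n(g) − ⟨f,g⟩_n², and Δ_n(f,g) = (Γ_n(f) + Γ_n(f,g))/(Γ_n(g) + 1). Then Δ_n(f,g) → ∞ as n → ∞ in each of the following cases: (a) Σ_k g_k² < ∞; (b) Σ_k g_k² = ∞ and Γ_n(f)/Γ_n(g) → ∞; (c) for every (C₁,C₂) ∈ ℝ² \ {(0,0)}, Σ_k (C₁ f_k + C₂ g_k)² = ∞. -/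
open Filter

/-- `Γ_n(f) = Σ_{k<n} f_k²`. -/
noncomputable def gramSq (f : ℕ → ℝ) (n : ℕ) : ℝ := ∑ k ∈ Finset.range n, f k ^ 2

/-- `⟨f,g⟩_n = Σ_{k<n} f_k g_k`. -/
noncomputable def ipTrunc (f g : ℕ → ℝ) (n : ℕ) : ℝ := ∑ k ∈ Finset.range n, f k * g k

/-- `Γ_n(f,g) = Γ_n(f)Γ_n(g) − ⟨f,g⟩_n²`, the Gram determinant of the truncations. -/
noncomputable def gramDet (f g : ℕ → ℝ) (n : ℕ) : ℝ :=
  gramSq f n * gramSq g n - ipTrunc f g n ^ 2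

/-- `Δ_n(f,g) = (Γ_n(f) + Γ_n(f,g))/(Γ_n(g) + 1)`. -/
noncomputable def deltaRatio (f g : ℕ → ℝ) (n : ℕ) : ℝ :=
  (gramSq f n + gramDet f g n) / (gramSq g n + 1)

/-- Expansion of `Γ_n(f - t g)` as a quadratic polynomial in `t`. -/
lemma gramSq_sub_mul (f g : ℕ → ℝ) (t : ℝ) (n : ℕ) :
    gramSq (fun k => f k - t * g k) n =
      gramSq f n - 2 * t * ipTrunc f g n + t ^ 2 * gramSq g n := by
  simp only [gramSq, ipTrunc, Finset.mul_sum, ← Finset.sum_sub_distrib, ← Finset.sum_add_distrib]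
  exact Finset.sum_congr rfl fun k _ => by ring

lemma gramSq_nonneg (f : ℕ → ℝ) (n : ℕ) : 0 ≤ gramSq f n :=
  Finset.sum_nonneg fun _ _ => sq_nonneg _

lemma gramSq_mono (f : ℕ → ℝ) : Monotone (gramSq f) := fun _ _ hmn =>
  Finset.sum_le_sum_of_subset_of_nonneg (Finset.range_mono hmn) fun _ _ _ => sq_nonneg _

lemma gramSq_le_tsum {f : ℕ → ℝ} (hf : Summable fun k => f k ^ 2) (n : ℕ) :
    gramSq f n ≤ ∑' k, f k ^ 2 :=
  hf.sum_le_tsum _ fun _ _ => sq_nonneg _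

/-- Completing the square: `Δ_n(f,g)` is the minimum over `t` of `Γ_n(f - t g) + t²`. -/
lemma gramSq_sub_mul_add_sq (f g : ℕ → ℝ) (t : ℝ) (n : ℕ) :
    gramSq (fun k => f k - t * g k) n + t ^ 2 =
      deltaRatio f g n + (gramSq g n + 1) * (t - ipTrunc f g n / (gramSq g n + 1)) ^ 2 := by
  have h : gramSq g n + 1 ≠ 0 := by linarith [gramSq_nonneg g n]
  rw [gramSq_sub_mul, deltaRatio, gramDet]
  field_simp
  ring

lemma deltaRatio_le (f g : ℕ → ℝ) (t : ℝ) (n : ℕ) :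
    deltaRatio f g n ≤ gramSq (fun k => f k - t * g k) n + t ^ 2 := by
  have h := gramSq_nonneg g n
  rw [gramSq_sub_mul_add_sq]
  exact le_add_of_nonneg_right (by positivity)

lemma exists_gramSq_add_sq_eq_deltaRatio (f g : ℕ → ℝ) (n : ℕ) :
    ∃ t : ℝ, gramSq (fun k => f k - t * g k) n + t ^ 2 = deltaRatio f g n :=
  ⟨ipTrunc f g n / (gramSq g n + 1), by rw [gramSq_sub_mul_add_sq]; simp⟩

lemma deltaRatio_mono (f g : ℕ → ℝ) : Monotone (deltaRatio f g) := fun m n hmn => by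
  obtain ⟨t, ht⟩ := exists_gramSq_add_sq_eq_deltaRatio f g n
  have := gramSq_mono (fun k => f k - t * g k) hmn
  linarith [deltaRatio_le f g t m]

/-- `Δ_n(f,g) → ∞` as soon as no `f - t g` is square summable. -/
lemma deltaRatio_tendsto_atTop_of_forall_not_summable (f g : ℕ → ℝ)
    (h : ∀ t : ℝ, ¬ Summable fun k => (f k - t * g k) ^ 2) :
    Tendsto (deltaRatio f g) atTop atTop := by
  refine tendsto_atTop_atTop_of_monotone (deltaRatio_mono f g) ?_
  by_contra! hM
  obtain ⟨M, hM⟩ := hM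
  let K : ℕ → Set ℝ := fun n => {t | gramSq (fun k => f k - t * g k) n + t ^ 2 ≤ M}
  have hclosed : ∀ n, IsClosed (K n) := fun n => by
    refine isClosed_le ?_ continuous_const
    simp only [gramSq]
    fun_prop
  have hcompact : IsCompact (K 0) := by
    refine (isCompact_Icc (a := -(|M| + 1)) (b := |M| + 1)).of_isClosed_subset (hclosed 0) ?_
    intro t ht
    have ht' : t ^ 2 ≤ M := by simpa [K, gramSq] using ht
    have := le_abs_self M
    exact abs_le.1 (abs_le_of_sq_le_sq (by nlinarith) (by positivity))
  obtain ⟨t, ht⟩ := IsCompact.nonempty_iInter_of_sequence_nonempty_isCompact_isClosed K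
    (fun n t ht => (add_le_add_left (gramSq_mono _ n.le_succ) _).trans ht)
    (fun n => by
      obtain ⟨t, ht⟩ := exists_gramSq_add_sq_eq_deltaRatio f g n
      exact ⟨t, ht.le.trans (hM n).le⟩)
    hcompact hclosed
  refine h t (summable_of_sum_range_le (c := M) (fun _ => sq_nonneg _) fun n => ?_)
  have hn : gramSq (fun k => f k - t * g k) n + t ^ 2 ≤ M := Set.mem_iInter.1 ht n
  change gramSq (fun k => f k - t * g k) n ≤ M
  linarith [sq_nonneg t]

lemma sq_le_two_mul_sub_mul_sq (x y t : ℝ) :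
    x ^ 2 ≤ 2 * (x - t * y) ^ 2 + 2 * t ^ 2 * y ^ 2 := by
  linarith [sq_nonneg (x - 2 * (t * y))]

lemma gramSq_le_of_sub_mul (f g : ℕ → ℝ) (t : ℝ) (n : ℕ) :
    gramSq f n ≤ 2 * gramSq (fun k => f k - t * g k) n + 2 * t ^ 2 * gramSq g n := by
  simp only [gramSq, Finset.mul_sum, ← Finset.sum_add_distrib]
  exact Finset.sum_le_sum fun k _ => sq_le_two_mul_sub_mul_sq _ _ _

lemma tendsto_gramSq_atTop {f : ℕ → ℝ} (hf : ¬ Summable fun k => f k ^ 2) :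
    Tendsto (gramSq f) atTop atTop :=
  (not_summable_iff_tendsto_nat_atTop_of_nonneg fun _ => sq_nonneg _).1 hf

/-- If `Σ f_k² = ∞`, then `Δ_n(f,g) → ∞` in each of the three cases:
(a) `Σ g_k² < ∞`; (b) `Σ g_k² = ∞` and `Γ_n(f)/Γ_n(g) → ∞`;
(c) `Σ (C₁f_k + C₂g_k)² = ∞` for all `(C₁,C₂) ≠ (0,0)`. -/
theorem deltaRatio_tendsto_atTop (f g : ℕ → ℝ)
    (hf : ¬ Summable fun k => f k ^ 2) :
    (Summable (fun k => g k ^ 2) →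
      Tendsto (deltaRatio f g) atTop atTop) ∧
    ((¬ Summable (fun k => g k ^ 2)) ∧
        Tendsto (fun n => gramSq f n / gramSq g n) atTop atTop →
      Tendsto (deltaRatio f g) atTop atTop) ∧
    ((∀ C₁ C₂ : ℝ, (C₁, C₂) ≠ (0, 0) →
        ¬ Summable fun k => (C₁ * f k + C₂ * g k) ^ 2) →
      Tendsto (deltaRatio f g) atTop atTop) := by
  refine ⟨fun hg => ?_, fun ⟨hg, hfg⟩ => ?_, fun h => ?_⟩ <;>
    refine deltaRatio_tendsto_atTop_of_forall_not_summable f g fun t ht => ?_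
  · exact hf (((ht.mul_left 2).add (hg.mul_left (2 * t ^ 2))).of_nonneg_of_le
      (fun _ => sq_nonneg _) fun k => sq_le_two_mul_sub_mul_sq _ _ _)
  · set S := ∑' k, (f k - t * g k) ^ 2
    obtain ⟨n, hn, hn'⟩ := ((hfg.eventually_gt_atTop (2 * S + 2 * t ^ 2)).and
      ((tendsto_gramSq_atTop hg).eventually_ge_atTop 1)).exists
    have hS : gramSq (fun k => f k - t * g k) n ≤ S := gramSq_le_tsum ht n
    have hS0 : 0 ≤ S := tsum_nonneg fun _ => sq_nonneg _
    rw [lt_div_iff₀ (by linarith)] at hn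
    nlinarith [gramSq_le_of_sub_mul f g t n]
  · refine h 1 (-t) (by simp) ?_
    simpa only [one_mul, neg_mul, ← sub_eq_add_neg] using ht
end

section
/- Let f, g : ℕ → ℝ be sequences such that for every (C₁,C₂) ∈ ℝ² \ {(0,0)} the series Σ_k (C₁ f_k + C₂ g_k)² diverges (in particular Σ f_k² = Σ g_k² = ∞). Then, with Γ_n(f) = Σ_{k<n} f_k², ⟨f,g⟩_n = Σ_{k<n} f_k g_k and Γ_n(f,g) = Γ_n(f)Γ_n(g) − ⟨f,g⟩_n², both ratios Γ_n(f,g)/Γ_n(g) and Γ_n(f,g)/Γ_n(f) tend to ∞ as n → ∞. -/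
open Filter

lemma gramSq_add_mul (f g : ℕ → ℝ) (t : ℝ) (n : ℕ) :
    gramSq (fun k => f k + t * g k) n
      = gramSq f n + 2 * t * ipTrunc f g n + t ^ 2 * gramSq g n := by
  simp only [gramSq, ipTrunc, Finset.mul_sum, ← Finset.sum_add_distrib]
  exact Finset.sum_congr rfl fun k _ => by ring

lemma sq_le_gramSq (f : ℕ → ℝ) {k n : ℕ} (hk : k < n) : f k ^ 2 ≤ gramSq f n :=
  Finset.single_le_sum (f := fun k => f k ^ 2) (fun _ _ => sq_nonneg _) (Finset.mem_range.2 hk)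

lemma gramDet_comm (f g : ℕ → ℝ) (n : ℕ) : gramDet f g n = gramDet g f n := by
  simp only [gramDet, ipTrunc, mul_comm]

/-- The ratio `Γ_n(f,g)/Γ_n(g)` is the value of `t ↦ Γ_n(f + t g)` at its minimizer. -/
lemma gramSq_add_mul_minimizer (f g : ℕ → ℝ) {n : ℕ} (hn : gramSq g n ≠ 0) :
    gramSq (fun k => f k + (-(ipTrunc f g n / gramSq g n)) * g k) n
      = gramDet f g n / gramSq g n := by
  rw [gramSq_add_mul, gramDet]
  field_simp
  ring

lemma isCompact_gramSq_add_mul_le (f g : ℕ → ℝ) (M : ℝ) {k n : ℕ} (hk : k < n) (hg : g k ≠ 0) :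
    IsCompact {t : ℝ | gramSq (fun k => f k + t * g k) n ≤ M} := by
  have hclosed : IsClosed {t : ℝ | gramSq (fun k => f k + t * g k) n ≤ M} := by
    refine isClosed_le ?_ continuous_const
    unfold gramSq
    fun_prop
  refine (isCompact_closedBall (0 : ℝ) ((√M + |f k|) / |g k|)).of_isClosed_subset hclosed ?_
  intro t ht
  have hsq : (f k + t * g k) ^ 2 ≤ M :=
    (sq_le_gramSq (fun k => f k + t * g k) hk).trans ht
  have habs : |f k + t * g k| ≤ √M := Real.abs_le_sqrt hsq
  rw [mem_closedBall_zero_iff, Real.norm_eq_abs, le_div_iff₀ (abs_pos.2 hg), ← abs_mul]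
  have htri := abs_sub (f k + t * g k) (f k)
  rw [add_sub_cancel_left] at htri
  linarith

lemma gramDet_div_tendsto_atTop (f g : ℕ → ℝ) (hg : ∃ k, g k ≠ 0)
    (h : ∀ t : ℝ, ¬ Summable fun k => (f k + t * g k) ^ 2) :
    Tendsto (fun n => gramDet f g n / gramSq g n) atTop atTop := by
  obtain ⟨k, hk⟩ := hg
  by_contra hnot
  obtain ⟨M, hM⟩ : ∃ M : ℝ, ∀ m, ∃ n ≥ m, gramDet f g n / gramSq g n < M := by
    simpa [tendsto_atTop, frequently_atTop] using hnot
  let K : ℕ → Set ℝ := fun m => {t | gramSq (fun k => f k + t * g k) (m + (k + 1)) ≤ M}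
  have hcompact (m : ℕ) : IsCompact (K m) :=
    isCompact_gramSq_add_mul_le f g M (by omega) hk
  have hne (m : ℕ) : (K m).Nonempty := by
    obtain ⟨n, hmn, hn⟩ := hM (m + (k + 1))
    have hpos : 0 < gramSq g n :=
      (pow_pos (abs_pos.2 hk) 2).trans_le ((sq_abs (g k)).trans_le (sq_le_gramSq g (by omega)))
    refine ⟨-(ipTrunc f g n / gramSq g n), (gramSq_mono _ hmn).trans ?_⟩
    rw [gramSq_add_mul_minimizer f g hpos.ne']
    exact hn.le
  obtain ⟨t, ht⟩ := IsCompact.nonempty_iInter_of_sequence_nonempty_isCompact_isClosed K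
    (fun m _ ht => (gramSq_mono _ (by omega)).trans ht) hne (hcompact 0)
    fun m => (hcompact m).isClosed
  refine h t (summable_of_sum_range_le (c := M) (fun _ => sq_nonneg _) fun n => ?_)
  exact (gramSq_mono (fun k => f k + t * g k) (Nat.le_add_right n (k + 1))).trans
    (Set.mem_iInter.1 ht n)

/-- If `Σ (C₁f_k + C₂g_k)²` diverges for every `(C₁,C₂) ≠ (0,0)`, then both
`Γ_n(f,g)/Γ_n(g)` and `Γ_n(f,g)/Γ_n(f)` tend to `∞`. -/
theorem gramDet_ratio_tendsto_atTop (f g : ℕ → ℝ)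
    (h : ∀ C₁ C₂ : ℝ, (C₁, C₂) ≠ (0, 0) →
      ¬ Summable fun k => (C₁ * f k + C₂ * g k) ^ 2) :
    Tendsto (fun n => gramDet f g n / gramSq g n) atTop atTop ∧
    Tendsto (fun n => gramDet f g n / gramSq f n) atTop atTop := by
  have hf : ∃ k, f k ≠ 0 := by
    by_contra! hzero
    exact h 1 0 (by simp) (by simp [hzero, summable_zero])
  have hg : ∃ k, g k ≠ 0 := by
    by_contra! hzero
    exact h 0 1 (by simp) (by simp [hzero, summable_zero])
  constructor
  · exact gramDet_div_tendsto_atTop f g hg fun t => by simpa using h 1 t (by simp)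
  · simp only [gramDet_comm f g]
    exact gramDet_div_tendsto_atTop g f hf fun t => by simpa [add_comm] using h t 1 (by simp)
end

section
/- Let (a_n) be a sequence of real numbers with a_n > −1 for all n. If the series Σ_n a_n² diverges, then the series Σ_n a_n²/(1 + a_n) also diverges. -/
/-- If `a n > -1` for all `n` and `Σ aₙ²` diverges, then `Σ aₙ²/(1+aₙ)` diverges. -/
theorem not_summable_sq_div_one_add (a : ℕ → ℝ) (ha : ∀ n, -1 < a n)
    (h : ¬ Summable fun n => a n ^ 2) :
    ¬ Summable fun n => a n ^ 2 / (1 + a n) := by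
  intro hs
  refine h (Summable.of_norm_bounded_eventually_nat (hs.mul_left 2) ?_)
  filter_upwards [hs.tendsto_atTop_zero.eventually_le_const
    (show (0 : ℝ) < 1 / 2 by norm_num)] with n hn
  have hpos : 0 < 1 + a n := by linarith [ha n]
  rw [div_le_iff₀ hpos] at hn
  have hle : a n ≤ 1 := by nlinarith
  rw [Real.norm_of_nonneg (sq_nonneg _), ← mul_div_assoc, le_div_iff₀ hpos]
  nlinarith [mul_nonneg (sq_nonneg (a n)) (sub_nonneg.2 hle)]
end

section
/- Let c : ℤ → ℝ be a sequence of positive reals and suppose that for every s > 0 the series Σ_n (s²/√(c_n) − √(c_n)/s²)² diverges. Then for every C > 0 both series Σ_n (1 − C·c_n)²/(1 + 2c_n) and Σ_n (c_n − C)²/(c_n² + 2c_n) diverge. -/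
/-- The square `(a / √x - √x / a)²`, with `a = s²` and `s` the fourth root of `t`, is a rational
function of `t` and `x`. -/
lemma sq_div_sqrt_sub_sqrt_div_eq {t x : ℝ} (ht : 0 < t) (hx : 0 < x) :
    (√(√t) ^ 2 / √x - √x / √(√t) ^ 2) ^ 2 = (t - x) ^ 2 / (t * x) := by
  have hx' : √x ≠ 0 := (Real.sqrt_pos.2 hx).ne'
  have ht' : √t ≠ 0 := (Real.sqrt_pos.2 ht).ne'
  rw [Real.sq_sqrt (Real.sqrt_nonneg t), div_sub_div _ _ hx' ht', div_pow, mul_pow,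
    ← sq, ← sq, Real.sq_sqrt ht.le, Real.sq_sqrt hx.le, mul_comm x t]

/-- A nonnegative family dominated by a multiple of a summable family `f` at every index where `f`
is smaller than a fixed positive number is summable. -/
lemma Summable.of_nonneg_of_le_mul_of_lt {ι : Type*} {f g : ι → ℝ} (hf : Summable f) {ε K : ℝ}
    (hε : 0 < ε) (hg : ∀ i, 0 ≤ g i) (hfg : ∀ i, f i < ε → g i ≤ K * f i) : Summable g := by
  refine Summable.of_norm_bounded_eventually (hf.mul_left K) ?_
  filter_upwards [hf.tendsto_cofinite_zero.eventually_lt_const hε] with i hi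
  rw [Real.norm_of_nonneg (hg i)]
  exact hfg i hi

/-- If for every `s > 0` the series `Σ (s²/√cₙ − √cₙ/s²)²` diverges, then for every `C > 0`
both `Σ (1 − C cₙ)²/(1 + 2cₙ)` and `Σ (cₙ − C)²/(cₙ² + 2cₙ)` diverge. -/
theorem park_lemma (c : ℤ → ℝ) (hc : ∀ n, 0 < c n)
    (h : ∀ s : ℝ, 0 < s →
      ¬ Summable fun n : ℤ => (s ^ 2 / Real.sqrt (c n) - Real.sqrt (c n) / s ^ 2) ^ 2) :
    ∀ C : ℝ, 0 < C →
      (¬ Summable fun n : ℤ => (1 - C * c n) ^ 2 / (1 + 2 * c n)) ∧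
      (¬ Summable fun n : ℤ => (c n - C) ^ 2 / (c n ^ 2 + 2 * c n)) := by
  have key : ∀ t : ℝ, 0 < t → ¬ Summable fun n : ℤ => (t - c n) ^ 2 / (t * c n) := by
    intro t ht hs
    refine h (√(√t)) (Real.sqrt_pos.2 (Real.sqrt_pos.2 ht)) ?_
    simpa only [sq_div_sqrt_sub_sqrt_div_eq ht (hc _)] using hs
  have nonneg : ∀ t : ℝ, 0 < t → ∀ n, 0 ≤ (t - c n) ^ 2 / (t * c n) := fun t ht n =>
    div_nonneg (sq_nonneg _) (mul_pos ht (hc n)).le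
  intro C hC
  refine ⟨fun hs => key C⁻¹ (inv_pos.2 hC) ?_, fun hs => key C hC ?_⟩
  · refine hs.of_nonneg_of_le_mul_of_lt (ε := C / (4 * (C + 1))) (K := 2 + 2 / C)
      (by positivity) (nonneg _ (inv_pos.2 hC)) fun n hn => ?_
    have hx := hc n
    generalize c n = x at hn hx ⊢
    have hle : 1 ≤ 2 * (C * x) := by
      by_contra! hlt
      rw [div_lt_div_iff₀ (by positivity) (by positivity)] at hn
      have hsq : 1 ≤ 4 * (1 - C * x) ^ 2 := by nlinarith
      nlinarith [mul_le_mul_of_nonneg_right hsq (by positivity : 0 ≤ C + 1)]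
    have hid : (C⁻¹ - x) ^ 2 / (C⁻¹ * x) =
        (1 / (C * x) + 2 / C) * ((1 - C * x) ^ 2 / (1 + 2 * x)) := by
      field_simp
    rw [hid]
    gcongr
    rw [div_le_iff₀ (by positivity)]
    exact hle
  · refine hs.of_nonneg_of_le_mul_of_lt (ε := C / (4 * (C + 1))) (K := (2 * C + 2) / C)
      (by positivity) (nonneg _ hC) fun n hn => ?_
    have hx := hc n
    generalize c n = x at hn hx ⊢
    have hle : x ≤ 2 * C := by
      by_contra! hlt
      rw [div_lt_div_iff₀ (by positivity) (by positivity)] at hn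
      have hsq : x ^ 2 ≤ 4 * (x - C) ^ 2 := by nlinarith
      nlinarith [mul_le_mul_of_nonneg_right hsq (by positivity : 0 ≤ C + 1), mul_pos hC hx]
    have hid : (C - x) ^ 2 / (C * x) = (x + 2) / C * ((x - C) ^ 2 / (x ^ 2 + 2 * x)) := by
      field_simp
      ring
    rw [hid]
    gcongr
end

section
/- Let b₁, b₂ : ℤ → ℝ be positive sequences and a₁, a₂ : ℤ → ℝ real sequences. Suppose there exists s > 0 such that the series Σ_n (s²·√(b₁(n)/b₂(n)) − s⁻²·√(b₂(n)/b₁(n)))² converges. Then for every (C₁,C₂) ∈ ℝ² \ {(0,0)}: if the series Σ_n (C₁²·b₁(n) + C₂²·b₂(n))·(C₁·a₁(n) + C₂·a₂(n))² diverges, then the series Σ_n (C₁·a₁(n) + C₂·a₂(n))² / (1/(2b₁(n)) + 1/(2b₂(n))) also diverges. -/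
theorem sq_mul_sqrt_div_sub {x y t : ℝ} (hx : 0 < x) (hy : 0 < y) (ht : 0 < t) :
    (t * Real.sqrt (x / y) - t⁻¹ * Real.sqrt (y / x)) ^ 2 =
      t ^ 2 * (x / y) + (t ^ 2)⁻¹ * (y / x) - 2 := by
  have hxy : Real.sqrt (x / y) ^ 2 = x / y := Real.sq_sqrt (by positivity)
  have hyx : Real.sqrt (y / x) ^ 2 = y / x := Real.sq_sqrt (by positivity)
  have hprod : Real.sqrt (x / y) * Real.sqrt (y / x) = 1 := by
    rw [← Real.sqrt_mul (by positivity), div_mul_div_cancel₀ hy.ne', div_self hx.ne',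
      Real.sqrt_one]
  have htt : t * t⁻¹ = 1 := mul_inv_cancel₀ ht.ne'
  calc (t * Real.sqrt (x / y) - t⁻¹ * Real.sqrt (y / x)) ^ 2
      = t ^ 2 * Real.sqrt (x / y) ^ 2 + (t ^ 2)⁻¹ * Real.sqrt (y / x) ^ 2
        - 2 * (t * t⁻¹) * (Real.sqrt (x / y) * Real.sqrt (y / x)) := by ring
    _ = t ^ 2 * (x / y) + (t ^ 2)⁻¹ * (y / x) - 2 := by
      rw [hxy, hyx, hprod, htt]; ring

/-- If `(t√(x/y) − t⁻¹√(y/x))²` is at most `T`, then `x` is at most a constant multiple of `y`. -/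
theorem le_mul_of_sq_mul_sqrt_div_sub_le {x y t T : ℝ} (hx : 0 < x) (hy : 0 < y) (ht : 0 < t)
    (h : (t * Real.sqrt (x / y) - t⁻¹ * Real.sqrt (y / x)) ^ 2 ≤ T) :
    x ≤ (T + 2) / t ^ 2 * y := by
  rw [sq_mul_sqrt_div_sub hx hy ht] at h
  have hpos : 0 < (t ^ 2)⁻¹ * (y / x) := by positivity
  rw [← div_le_iff₀ hy, le_div_iff₀ (by positivity)]
  linarith

/-- Two comparable weights are dominated by a multiple of their harmonic mean. -/
theorem add_mul_le_div_harmonic {x y p q c K L : ℝ} (hx : 0 < x) (hy : 0 < y) (hp : 0 ≤ p)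
    (hq : 0 ≤ q) (hc : 0 ≤ c) (hxy : x ≤ K * y) (hyx : y ≤ L * x) :
    (p * x + q * y) * c ≤
      (p * (1 + K) + q * (1 + L)) / 2 * (c / (1 / (2 * x) + 1 / (2 * y))) := by
  have hharm : c / (1 / (2 * x) + 1 / (2 * y)) = 2 * x * y / (x + y) * c := by
    field_simp
    ring
  have hxm : x ≤ (1 + K) / 2 * (2 * x * y / (x + y)) := by
    rw [← mul_div_assoc, le_div_iff₀ (by positivity)]
    nlinarith
  have hym : y ≤ (1 + L) / 2 * (2 * x * y / (x + y)) := by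
    rw [← mul_div_assoc, le_div_iff₀ (by positivity)]
    nlinarith
  rw [hharm, ← mul_assoc]
  refine mul_le_mul_of_nonneg_right ?_ hc
  linarith [mul_le_mul_of_nonneg_left hxm hp, mul_le_mul_of_nonneg_left hym hq]

/-- If `Σ (s²√(b₁/b₂) − s⁻²√(b₂/b₁))²` converges for some `s > 0`, then for every
`(C₁,C₂) ≠ (0,0)`, divergence of `Σ (C₁²b₁ + C₂²b₂)(C₁a₁ + C₂a₂)²` implies divergence of
`Σ (C₁a₁ + C₂a₂)² / (1/(2b₁) + 1/(2b₂))`. -/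
theorem the_last_lemma (b₁ b₂ a₁ a₂ : ℤ → ℝ)
    (hb₁ : ∀ n, 0 < b₁ n) (hb₂ : ∀ n, 0 < b₂ n)
    (h : ∃ s : ℝ, 0 < s ∧ Summable fun n : ℤ =>
      (s ^ 2 * Real.sqrt (b₁ n / b₂ n) - (s ^ 2)⁻¹ * Real.sqrt (b₂ n / b₁ n)) ^ 2)
    (C₁ C₂ : ℝ) (hC : (C₁, C₂) ≠ (0, 0))
    (hdiv : ¬ Summable fun n : ℤ =>
      (C₁ ^ 2 * b₁ n + C₂ ^ 2 * b₂ n) * (C₁ * a₁ n + C₂ * a₂ n) ^ 2) :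
    ¬ Summable fun n : ℤ =>
      (C₁ * a₁ n + C₂ * a₂ n) ^ 2 / (1 / (2 * b₁ n) + 1 / (2 * b₂ n)) := by
  obtain ⟨s, hs, hsum⟩ := h
  intro hconv
  have hbound := fun n => hsum.le_tsum n fun _ _ => sq_nonneg _
  set T := ∑' n : ℤ,
    (s ^ 2 * Real.sqrt (b₁ n / b₂ n) - (s ^ 2)⁻¹ * Real.sqrt (b₂ n / b₁ n)) ^ 2
  have h₁₂ (n : ℤ) : b₁ n ≤ (T + 2) / (s ^ 2) ^ 2 * b₂ n :=
    le_mul_of_sq_mul_sqrt_div_sub_le (hb₁ n) (hb₂ n) (by positivity) (hbound n)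
  have h₂₁ (n : ℤ) : b₂ n ≤ (T + 2) / (s ^ 2)⁻¹ ^ 2 * b₁ n := by
    refine le_mul_of_sq_mul_sqrt_div_sub_le (hb₂ n) (hb₁ n) (by positivity) ?_
    rw [inv_inv, sub_sq_comm]
    exact hbound n
  have hle (n : ℤ) := add_mul_le_div_harmonic (hb₁ n) (hb₂ n) (sq_nonneg C₁) (sq_nonneg C₂)
    (sq_nonneg (C₁ * a₁ n + C₂ * a₂ n)) (h₁₂ n) (h₂₁ n)
  refine hdiv (.of_nonneg_of_le (fun n => ?_) hle (hconv.mul_left _))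
  have := hb₁ n
  have := hb₂ n
  positivity
end

section
/- For every real m×m matrix X, det(I + Xᵀ X) = 1 + Σ_{r=1}^{m} Σ (M^{i₁…i_r}_{j₁…j_r}(X))², where the inner sum runs over all pairs of index sequences 1 ≤ i₁ < i₂ < … < i_r ≤ m and 1 ≤ j₁ < j₂ < … < j_r ≤ m, and M^{i₁…i_r}_{j₁…j_r}(X) denotes the r×r minor of X formed by rows i₁,…,i_r and columns j₁,…,j_r. -/
open Matrix

/-- The determinant of `1 + M` is the sum of all principal minors of `M`. -/
theorem Matrix.det_one_add_eq_sum_principal_minors {n R : Type*} [CommRing R] [DecidableEq n]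
    [Fintype n] (M : Matrix n n R) :
    (1 + M).det = ∑ s : Finset n, (M.submatrix (Subtype.val : s → n) Subtype.val).det := by
  rw [add_comm]
  refine ((detRowAlternating (R := R) (n := n)).map_add_univ M (1 : Matrix n n R)).trans ?_
  exact Finset.sum_congr rfl fun s _ => det_piecewise_one_eq_submatrix_det M s

/-- The determinant of a submatrix of a product, expanded over all maps of indices. -/
theorem Matrix.det_mul_eq_sum_fun {n k R : Type*} [CommRing R] [DecidableEq n] [Fintype n]
    [DecidableEq k] [Fintype k] (A : Matrix n k R) (B : Matrix k n R) :
    (A * B).det = ∑ f : n → k, (∏ i, A i (f i)) * (B.submatrix f id).det := by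
  have h : A * B = fun i => ∑ j, A i j • B j := by
    ext i j
    simp [Matrix.mul_apply]
  rw [h]
  refine ((detRowAlternating (R := R) (n := n)).toMultilinearMap.map_sum
    (fun i j => A i j • B j)).trans (Finset.sum_congr rfl fun f _ => ?_)
  exact ((detRowAlternating (R := R) (n := n)).toMultilinearMap.map_smul_univ
    (fun i => A i (f i)) (fun i => B (f i)))

/-- The injective maps `Fin r → k` with image `s` are the permutations of the increasing
enumeration of `s`. -/
theorem Finset.sum_injective_image_eq {r : ℕ} {k M : Type*} [LinearOrder k] [Fintype k]
    [AddCommMonoid M] (s : Finset k) (hs : s.card = r) (g : (Fin r → k) → M) :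
    ∑ f : Fin r → k with f.Injective ∧ Finset.univ.image f = s, g f =
      ∑ σ : Equiv.Perm (Fin r), g (s.orderEmbOfFin hs ∘ σ) := by
  symm
  refine Finset.sum_bij (fun σ _ => s.orderEmbOfFin hs ∘ σ) ?_ ?_ ?_ fun _ _ => rfl
  · intro σ _
    refine Finset.mem_filter.2
      ⟨Finset.mem_univ _, (s.orderEmbOfFin hs).injective.comp σ.injective, ?_⟩
    rw [← Finset.image_image, Finset.image_univ_equiv, Finset.image_orderEmbOfFin_univ]
  · intro σ _ τ _ h
    ext i
    exact congrArg Fin.val ((s.orderEmbOfFin hs).injective (congrFun h i))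
  · intro f hf
    obtain ⟨-, hinj, him⟩ := Finset.mem_filter.1 hf
    have hmem (i : Fin r) : f i ∈ s := him ▸ Finset.mem_image_of_mem f (Finset.mem_univ i)
    have hσ : Function.Injective fun i => (s.orderIsoOfFin hs).symm ⟨f i, hmem i⟩ := by
      intro i j h
      exact hinj (congrArg Subtype.val ((s.orderIsoOfFin hs).symm.injective h))
    refine ⟨Equiv.ofBijective _ (Finite.injective_iff_bijective.1 hσ), Finset.mem_univ _, ?_⟩
    ext i
    simp [← Finset.coe_orderIsoOfFin_apply]

/-- The **Cauchy–Binet formula**. -/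
theorem Matrix.det_mul_eq_sum_minors {r : ℕ} {k R : Type*} [CommRing R] [LinearOrder k]
    [Fintype k] (A : Matrix (Fin r) k R) (B : Matrix k (Fin r) R) :
    (A * B).det = ∑ s ∈ (Finset.powersetCard r (Finset.univ : Finset k)).attach,
      (A.submatrix id (s.1.orderEmbOfFin (Finset.mem_powersetCard.mp s.2).2)).det *
      (B.submatrix (s.1.orderEmbOfFin (Finset.mem_powersetCard.mp s.2).2) id).det := by
  set g : (Fin r → k) → R := fun f => (∏ i, A i (f i)) * (B.submatrix f id).det
  have hinj : ∑ f, g f = ∑ f : Fin r → k with f.Injective, g f := by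
    refine (Finset.sum_filter_of_ne fun f _ hf => ?_).symm
    intro i j hij
    by_contra hne
    exact hf (mul_eq_zero_of_right _ (det_zero_of_row_eq hne (by ext; simp [hij])))
  have hmaps : ∀ f ∈ Finset.univ.filter (fun f : Fin r → k => f.Injective),
      Finset.univ.image f ∈ Finset.powersetCard r (Finset.univ : Finset k) := by
    intro f hf
    simp [Finset.mem_powersetCard, Finset.card_image_of_injective _ (Finset.mem_filter.1 hf).2]
  rw [det_mul_eq_sum_fun, hinj, ← Finset.sum_fiberwise_of_maps_to hmaps, ← Finset.sum_attach]
  refine Finset.sum_congr rfl fun s _ => ?_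
  rw [Finset.filter_filter,
    Finset.sum_injective_image_eq s.1 (Finset.mem_powersetCard.mp s.2).2 g,
    ← det_transpose (A.submatrix _ _), det_apply, Finset.sum_mul]
  refine Finset.sum_congr rfl fun σ _ => ?_
  have hB := det_permute σ (B.submatrix (s.1.orderEmbOfFin (Finset.mem_powersetCard.mp s.2).2) id)
  rw [submatrix_submatrix] at hB
  simp only [g]
  rw [show (id : Fin r → Fin r) = id ∘ id from rfl, hB]
  simp [Units.smul_def]
  ring

/-- `det(I + XᵀX) = 1 + Σ_{r=1}^m Σ_{i₁<…<i_r, j₁<…<j_r} (M^{i₁…i_r}_{j₁…j_r}(X))²`,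
the sum of the squares of all minors of `X`. -/
theorem det_one_add_transpose_mul_self_eq_sum_sq_minors
    (m : ℕ) (X : Matrix (Fin m) (Fin m) ℝ) :
    (1 + Xᵀ * X).det =
      1 + ∑ r ∈ Finset.Icc 1 m,
        ∑ s ∈ (Finset.powersetCard r (Finset.univ : Finset (Fin m))).attach,
          ∑ t ∈ (Finset.powersetCard r (Finset.univ : Finset (Fin m))).attach,
            (X.submatrix
              (s.1.orderEmbOfFin (Finset.mem_powersetCard.mp s.2).2)
              (t.1.orderEmbOfFin (Finset.mem_powersetCard.mp t.2).2)).det ^ 2 := by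
  rw [det_one_add_eq_sum_principal_minors, ← Finset.powerset_univ, Finset.sum_powerset,
    Finset.card_univ, Fintype.card_fin, Finset.range_eq_Ico,
    Finset.sum_eq_sum_Ico_succ_bot (Nat.succ_pos m)]
  congr 1
  · simp
  refine Finset.sum_congr rfl fun r _ => ?_
  rw [Finset.sum_comm, ← Finset.sum_attach]
  refine Finset.sum_congr rfl fun t _ => ?_
  have ht := (Finset.mem_powersetCard.mp t.2).2
  rw [← det_submatrix_equiv_self (t.1.orderIsoOfFin ht).toEquiv, submatrix_submatrix]
  change ((Xᵀ * X).submatrix (t.1.orderEmbOfFin ht) (t.1.orderEmbOfFin ht)).det = _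
  rw [submatrix_mul Xᵀ X _ id _ Function.bijective_id, det_mul_eq_sum_minors]
  refine Finset.sum_congr rfl fun s _ => ?_
  rw [sq, ← det_transpose (submatrix (submatrix Xᵀ _ _) _ _)]
  rfl
end

section
/- Let x₁,…,x_m be vectors in a real inner product space, let γ(x₁,…,x_m) be their Gram matrix, and let λ₁,…,λ_m be nonzero real numbers. Then det(diag(λ₁,…,λ_m) + γ(x₁,…,x_m)) = (Π_{k=1}^m λ_k) · (1 + Σ_{r=1}^m Σ_{1≤i₁<…<i_r≤m} (λ_{i₁}·λ_{i₂}·…·λ_{i_r})⁻¹ · Γ(x_{i₁},…,x_{i_r})), where Γ(x_{i₁},…,x_{i_r}) is the Gram determinant of the vectors x_{i₁},…,x_{i_r}. -/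
open Matrix RealInnerProductSpace

/-- The determinant of a diagonal matrix plus `M`, expanded in the principal minors of `M`. -/
theorem Matrix.det_diagonal_add_eq_sum_minors {n R : Type*} [Fintype n] [DecidableEq n]
    [CommRing R] (d : n → R) (M : Matrix n n R) :
    (diagonal d + M).det =
      ∑ s : Finset n, (∏ i ∈ sᶜ, d i) * (M.submatrix (Subtype.val : s → n) Subtype.val).det := by
  have h := (detRowAlternating : (n → R) [⋀^n]→ₗ[R] R).map_add_univ M.row (diagonal d).row
  rw [add_comm]
  refine h.trans (Finset.sum_congr rfl fun s _ => ?_)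
  have hs : s.piecewise M.row (diagonal d).row =
      fun i => (if i ∈ s then 1 else d i) • s.piecewise M.row (1 : Matrix n n R).row i := by
    funext i j
    by_cases hi : i ∈ s <;> simp [hi, diagonal_apply, one_apply]
  rw [hs, AlternatingMap.map_smul_univ, ← det_piecewise_one_eq_submatrix_det, smul_eq_mul]
  congr 1
  rw [← Finset.prod_mul_prod_compl s, Finset.prod_congr rfl fun i hi => if_pos hi,
    Finset.prod_const_one, one_mul]
  exact Finset.prod_congr rfl fun i hi => if_neg (Finset.mem_compl.mp hi)

/-- A principal minor may be computed by listing its index set in increasing order. -/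
theorem Matrix.det_submatrix_orderEmbOfFin {n R : Type*} [LinearOrder n] [CommRing R]
    (M : Matrix n n R) {s : Finset n} {r : ℕ} (h : s.card = r) :
    (M.submatrix (s.orderEmbOfFin h) (s.orderEmbOfFin h)).det =
      (M.submatrix (Subtype.val : s → n) Subtype.val).det :=
  det_submatrix_equiv_self (s.orderIsoOfFin h).toEquiv (M.submatrix Subtype.val Subtype.val)

/-- `det(diag(λ) + γ(x₁,…,x_m)) = (Π λ_k)(1 + Σ_{r=1}^m Σ_{i₁<…<i_r} (λ_{i₁}⋯λ_{i_r})⁻¹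
Γ(x_{i₁},…,x_{i_r}))`, where `γ` is the Gram matrix and `Γ` the Gram determinant. -/
theorem det_diagonal_add_gram_eq
    {H : Type*} [NormedAddCommGroup H] [InnerProductSpace ℝ H]
    (m : ℕ) (x : Fin m → H) (lam : Fin m → ℝ) (hlam : ∀ k, lam k ≠ 0) :
    (Matrix.diagonal lam + Matrix.of fun i j => ⟪x i, x j⟫).det =
      (∏ k, lam k) *
        (1 + ∑ r ∈ Finset.Icc 1 m,
          ∑ s ∈ (Finset.powersetCard r (Finset.univ : Finset (Fin m))).attach,
            (∏ i ∈ s.1, lam i)⁻¹ *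
              (Matrix.of fun a b : Fin r =>
                ⟪x (s.1.orderEmbOfFin (Finset.mem_powersetCard.mp s.2).2 a),
                 x (s.1.orderEmbOfFin (Finset.mem_powersetCard.mp s.2).2 b)⟫).det) := by
  set G : Matrix (Fin m) (Fin m) ℝ := Matrix.of fun i j => ⟪x i, x j⟫
  set f : Finset (Fin m) → ℝ := fun s =>
    (∏ i ∈ s, lam i)⁻¹ * (G.submatrix (Subtype.val : s → Fin m) Subtype.val).det with hf
  have hminor (r : ℕ) : ∑ s ∈ (Finset.powersetCard r (Finset.univ : Finset (Fin m))).attach,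
      (∏ i ∈ s.1, lam i)⁻¹ * (Matrix.of fun a b : Fin r =>
        ⟪x (s.1.orderEmbOfFin (Finset.mem_powersetCard.mp s.2).2 a),
         x (s.1.orderEmbOfFin (Finset.mem_powersetCard.mp s.2).2 b)⟫).det =
      ∑ s ∈ Finset.powersetCard r Finset.univ, f s := by
    rw [← Finset.sum_attach _ f]
    refine Finset.sum_congr rfl fun s _ => congrArg ((∏ i ∈ s.1, lam i)⁻¹ * ·) ?_
    exact G.det_submatrix_orderEmbOfFin (Finset.mem_powersetCard.mp s.2).2
  have hempty : f ∅ = 1 := by simp [hf]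
  have hsum : 1 + ∑ r ∈ Finset.Icc 1 m, ∑ s ∈ Finset.powersetCard r Finset.univ, f s =
      ∑ s, f s := by
    rw [← Finset.powerset_univ, Finset.sum_powerset, Finset.card_univ, Fintype.card_fin,
      Finset.range_eq_Ico, Finset.sum_eq_sum_Ico_succ_bot m.succ_pos]
    simp [hempty, Finset.Ico_add_one_right_eq_Icc]
  rw [Finset.sum_congr rfl fun r _ => hminor r, hsum, det_diagonal_add_eq_sum_minors,
    Finset.mul_sum]
  refine Finset.sum_congr rfl fun s _ => ?_
  have hs : ∏ i ∈ s, lam i ≠ 0 := Finset.prod_ne_zero_iff.mpr fun k _ => hlam k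
  rw [← Finset.prod_mul_prod_compl s lam, hf]
  field_simp
end

section
/- Let λ₁,…,λ_m be nonzero real numbers with 1 + Σ_{k=1}^m 1/λ_k ≠ 0, so that the matrix D(λ₁,…,λ_m) (the all-ones matrix plus diag(λ)) is invertible, and let μ = (μ₁,…,μ_m) ∈ ℝ^m. Then ⟨D(λ₁,…,λ_m)⁻¹ μ, μ⟩ = (Σ_{k=1}^m μ_k²/λ_k + Σ_{1≤k<n≤m} (μ_k − μ_n)²/(λ_k λ_n)) / (1 + Σ_{k=1}^m 1/λ_k). -/
open Matrix

/-- Sherman–Morrison formula for the all-ones matrix plus an invertible diagonal matrix. -/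
theorem inv_allOnes_add_diagonal {ι K : Type*} [Fintype ι] [DecidableEq ι] [Field K]
    (d : ι → K) (hd : ∀ k, d k ≠ 0) (hsum : 1 + ∑ k, (d k)⁻¹ ≠ 0) :
    ((Matrix.of fun _ _ : ι => (1 : K)) + Matrix.diagonal d)⁻¹ =
      Matrix.diagonal (fun k => (d k)⁻¹) -
        Matrix.of fun i j => (1 + ∑ k, (d k)⁻¹)⁻¹ * ((d i)⁻¹ * (d j)⁻¹) := by
  apply Matrix.inv_eq_right_inv
  ext i k
  rw [add_mul, Matrix.add_apply, Matrix.diagonal_mul, Matrix.mul_apply]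
  simp only [Matrix.of_apply, Matrix.sub_apply, one_mul, Finset.sum_sub_distrib,
    ← Finset.mul_sum, ← Finset.sum_mul, Matrix.diagonal_apply, Matrix.one_apply]
  rw [Finset.sum_ite_eq' Finset.univ k]
  have hi := hd i
  have hk := hd k
  generalize ∑ k, (d k)⁻¹ = L at *
  by_cases h : i = k
  · subst h
    simp only [Finset.mem_univ, if_true]
    field_simp
    ring
  · simp only [Finset.mem_univ, if_true, h, if_false]
    field_simp
    ring

/-- A symmetric double sum vanishing on the diagonal is twice its strictly upper triangular part. -/
theorem sum_sum_eq_two_mul_sum_sum_lt {ι R : Type*} [Fintype ι] [LinearOrder ι] [CommSemiring R]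
    (f : ι → ι → R) (hsymm : ∀ k n, f k n = f n k) (hdiag : ∀ k, f k k = 0) :
    ∑ k, ∑ n, f k n = 2 * ∑ k, ∑ n, if k < n then f k n else 0 := by
  have hsplit : ∀ k n, f k n = (if k < n then f k n else 0) + if n < k then f n k else 0 := by
    intro k n
    rcases lt_trichotomy k n with h | h | h
    · simp [h, h.not_gt]
    · simp [h, hdiag]
    · simp [h, h.not_gt, hsymm k n]
  rw [two_mul]
  conv_lhs => enter [2, k, 2, n]; rw [hsplit k n]
  simp only [Finset.sum_add_distrib]
  congr 1
  exact Finset.sum_comm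

/-- Lagrange's identity for the sums `∑ μ²/d`, `∑ 1/d` and `∑ μ/d`. -/
theorem sum_sum_lt_sub_sq_div {ι : Type*} [Fintype ι] [LinearOrder ι] (d μ : ι → ℝ) :
    (∑ k, ∑ n, if k < n then (μ k - μ n) ^ 2 / (d k * d n) else 0) =
      (∑ k, μ k ^ 2 / d k) * ∑ k, (d k)⁻¹ - (∑ k, μ k / d k) ^ 2 := by
  have h := sum_sum_eq_two_mul_sum_sum_lt (fun k n => (μ k - μ n) ^ 2 / (d k * d n))
    (fun k n => by ring) (fun k => by simp)
  have hexpand : ∑ k, ∑ n, (μ k - μ n) ^ 2 / (d k * d n) =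
      (∑ k, μ k ^ 2 / d k) * (∑ k, (d k)⁻¹) + (∑ k, (d k)⁻¹) * (∑ k, μ k ^ 2 / d k) -
        2 * ((∑ k, μ k / d k) * ∑ k, μ k / d k) := by
    simp only [Finset.sum_mul_sum]
    simp only [Finset.mul_sum, ← Finset.sum_add_distrib,
      ← Finset.sum_sub_distrib]
    refine Finset.sum_congr rfl fun k _ => Finset.sum_congr rfl fun n _ => ?_
    simp only [div_eq_mul_inv, mul_inv]
    ring
  linarith

/-- For `D(λ)` the all-ones matrix plus `diag(λ)` with `λ_k ≠ 0` and `1 + Σ 1/λ_k ≠ 0`,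
`⟨D(λ)⁻¹ μ, μ⟩ = (Σ μ_k²/λ_k + Σ_{k<n} (μ_k − μ_n)²/(λ_k λ_n)) / (1 + Σ 1/λ_k)`. -/
theorem inv_allOnes_add_diagonal_quadratic_form
    (m : ℕ) (lam : Fin m → ℝ) (hlam : ∀ k, lam k ≠ 0)
    (hsum : 1 + ∑ k, (lam k)⁻¹ ≠ 0) (μ : Fin m → ℝ) :
    (((Matrix.of fun _ _ : Fin m => (1 : ℝ)) + Matrix.diagonal lam)⁻¹).mulVec μ ⬝ᵥ μ =
      (∑ k, μ k ^ 2 / lam k +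
        ∑ k, ∑ n, if k < n then (μ k - μ n) ^ 2 / (lam k * lam n) else 0) /
      (1 + ∑ k, (lam k)⁻¹) := by
  have hform : (((Matrix.of fun _ _ : Fin m => (1 : ℝ)) + Matrix.diagonal lam)⁻¹).mulVec μ ⬝ᵥ μ =
      ∑ k, μ k ^ 2 / lam k - (1 + ∑ k, (lam k)⁻¹)⁻¹ * (∑ k, μ k / lam k) ^ 2 := by
    rw [inv_allOnes_add_diagonal lam hlam hsum, Matrix.sub_mulVec, sub_dotProduct]
    congr 1
    · simp only [dotProduct, Matrix.mulVec_diagonal]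
      exact Finset.sum_congr rfl fun k _ => by ring
    · rw [sq, Finset.sum_mul_sum]
      simp only [dotProduct, Matrix.mulVec, Matrix.of_apply, Finset.sum_mul, Finset.mul_sum]
      exact Finset.sum_congr rfl fun k _ => Finset.sum_congr rfl fun n _ => by ring
  rw [hform, sum_sum_lt_sub_sq_div, eq_div_iff hsum, sub_mul, mul_right_comm,
    inv_mul_cancel₀ hsum]
  ring
end

section
/- Let B and C be real symmetric positive definite m×m matrices, and for a positive definite matrix A let p_A : ℝ^m → ℝ denote the centered Gaussian density p_A(x) = √(det A / π^m) · exp(−⟨Ax, x⟩). Then the Hellinger integral ∫_{ℝ^m} √(p_B(x) · p_C(x)) dx equals (det B · det C)^{1/4} / (det((B+C)/2))^{1/2}. -/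
open Matrix MeasureTheory

open scoped MatrixOrder in
/-- The Gaussian integral `∫ exp(-⟨Ax, x⟩) = √(πᵐ / det A)` of a positive definite matrix. -/
theorem integral_exp_neg_mulVec_dotProduct {ι : Type*} [Fintype ι] [DecidableEq ι]
    {A : Matrix ι ι ℝ} (hA : A.PosDef) :
    ∫ x : ι → ℝ, Real.exp (-(A.mulVec x ⬝ᵥ x)) =
      Real.sqrt (Real.pi ^ Fintype.card ι) / Real.sqrt A.det := by
  obtain ⟨D, rfl⟩ : ∃ D : Matrix ι ι ℝ, A = Dᵀ * D := by
    obtain ⟨D, hD⟩ := CStarAlgebra.nonneg_iff_eq_star_mul_self.mp hA.posSemidef.nonneg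
    exact ⟨D, by rw [hD, star_eq_conjTranspose, conjTranspose_eq_transpose_of_trivial]⟩
  have hD : D.det ≠ 0 := by
    have := hA.det_pos
    rw [det_mul, det_transpose] at this
    exact mul_self_pos.mp this
  have hquad (x : ι → ℝ) : (Dᵀ * D).mulVec x ⬝ᵥ x = ∑ i, (toLin' D x) i ^ 2 := by
    rw [← mulVec_mulVec, mulVec_transpose, ← dotProduct_mulVec]
    simp [dotProduct, sq]
  have hstd : ∫ y : ι → ℝ, Real.exp (-∑ i, y i ^ 2) = Real.sqrt (Real.pi ^ Fintype.card ι) := by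
    simp_rw [← Finset.sum_neg_distrib, Real.exp_sum]
    rw [integral_fintype_prod_volume_eq_pow (fun t : ℝ => Real.exp (-t ^ 2))]
    have := integral_gaussian 1
    simp only [neg_one_mul, div_one] at this
    rw [this, Real.sqrt_eq_rpow, Real.sqrt_eq_rpow, ← Real.rpow_natCast, ← Real.rpow_natCast,
      ← Real.rpow_mul Real.pi_pos.le, ← Real.rpow_mul Real.pi_pos.le, mul_comm]
  have hmap := integral_map (μ := volume) (φ := toLin' D)
    (f := fun y : ι → ℝ => Real.exp (-∑ i, y i ^ 2))
    (toLin' D).continuous_of_finiteDimensional.aemeasurable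
    (Continuous.aestronglyMeasurable (by fun_prop))
  simp_rw [hquad]
  rw [← hmap, Real.map_matrix_volume_pi_eq_smul_volume_pi hD, integral_smul_measure, hstd,
    ENNReal.toReal_ofReal (abs_nonneg _), det_mul, det_transpose, Real.sqrt_mul_self_eq_abs,
    abs_inv, smul_eq_mul, div_eq_inv_mul]

/-- The Hellinger integral of two centered Gaussian densities:
`∫ √(p_B p_C) = (det B · det C)^{1/4} / det((B+C)/2)^{1/2}`, where
`p_A(x) = √(det A/πᵐ) exp(−⟨Ax,x⟩)`. -/
theorem hellinger_integral_gaussian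
    (m : ℕ) (B C : Matrix (Fin m) (Fin m) ℝ) (hB : B.PosDef) (hC : C.PosDef)
    (p : Matrix (Fin m) (Fin m) ℝ → (Fin m → ℝ) → ℝ)
    (hp : ∀ A x, p A x = Real.sqrt (A.det / Real.pi ^ m) * Real.exp (-(A.mulVec x ⬝ᵥ x))) :
    ∫ x : Fin m → ℝ, Real.sqrt (p B x * p C x) =
      (B.det * C.det) ^ ((1 : ℝ) / 4) / Real.sqrt (((1 / 2 : ℝ) • (B + C)).det) := by
  have hM : ((1 / 2 : ℝ) • (B + C)).PosDef := (hB.add hC).smul (by norm_num)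
  have hb := hB.det_pos
  have hc := hC.det_pos
  have hπ : 0 < Real.pi ^ m := pow_pos Real.pi_pos m
  have hexp (x : Fin m → ℝ) : Real.sqrt (p B x * p C x) =
      (B.det * C.det) ^ ((1 : ℝ) / 4) / Real.sqrt (Real.pi ^ m) *
        Real.exp (-(((1 / 2 : ℝ) • (B + C)).mulVec x ⬝ᵥ x)) := by
    have hquarter : ((B.det * C.det) ^ ((1 : ℝ) / 4)) ^ 2 = Real.sqrt (B.det * C.det) := by
      rw [← Real.rpow_natCast, ← Real.rpow_mul (by positivity), Real.sqrt_eq_rpow]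
      norm_num
    rw [Real.sqrt_eq_iff_eq_sq (by rw [hp, hp]; positivity) (by positivity), hp, hp, mul_pow,
      div_pow, hquarter, Real.sq_sqrt hπ.le, ← Real.exp_nat_mul, mul_mul_mul_comm,
      ← Real.exp_add, Real.sqrt_div hb.le, Real.sqrt_div hc.le, div_mul_div_comm,
      Real.mul_self_sqrt hπ.le, Real.sqrt_mul hb.le, smul_mulVec, add_mulVec, smul_dotProduct,
      add_dotProduct]
    congr 2
    push_cast
    rw [smul_eq_mul]
    ring
  simp_rw [hexp]
  rw [integral_const_mul, integral_exp_neg_mulVec_dotProduct hM, Fintype.card_fin]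
  have := (Real.sqrt_pos.mpr hπ).ne'
  field_simp
end

section
/- (Hadamard–Fischer inequality) Let C be a real symmetric positive definite m×m matrix. For a subset α ⊆ {1,…,m} let M(α) denote the principal minor of C on the rows and columns indexed by α, with the convention M(∅) = 1. Then for any two subsets α, β ⊆ {1,…,m}, M(α) · M(β) ≥ M(α ∪ β) · M(α ∩ β). -/
open Matrix

namespace Matrix

variable {m n p : Type*} [Fintype m] [Fintype n] [Fintype p]
  [DecidableEq m] [DecidableEq n] [DecidableEq p]

theorem PosSemidef.one_le_det_one_add {K : Matrix n n ℝ} (hK : K.PosSemidef) :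
    1 ≤ (1 + K).det := by
  have h : (1 + K).det = ∏ i, (1 + hK.1.eigenvalues i) := by
    conv_lhs => rw [hK.1.spectral_theorem, Unitary.conjStarAlgAut_apply]
    rw [det_one_add_mul_comm, ← mul_assoc, Unitary.coe_star_mul_self, one_mul,
      ← diagonal_one, diagonal_add, det_diagonal]
    simp
  rw [h]
  exact Finset.one_le_prod fun i _ => le_add_of_nonneg_right (hK.eigenvalues_nonneg i)

open scoped MatrixOrder in
/-- The determinant is monotone in the Loewner order on positive definite matrices. -/
theorem PosDef.det_le_det_add {X Y : Matrix n n ℝ} (hX : X.PosDef) (hY : Y.PosSemidef) :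
    X.det ≤ (X + Y).det := by
  obtain ⟨L, rfl⟩ := CStarAlgebra.nonneg_iff_eq_star_mul_self.mp hX.posSemidef.nonneg
  rw [star_eq_conjTranspose] at hX ⊢
  have hdet : IsUnit L.det :=
    isUnit_of_mul_isUnit_right (det_mul Lᴴ L ▸ hX.det_pos.ne'.isUnit)
  have key : Lᴴ * L + Y = Lᴴ * (1 + (L⁻¹)ᴴ * Y * L⁻¹) * L := by
    have h : Lᴴ * (L⁻¹)ᴴ = 1 := by
      rw [← conjTranspose_mul, nonsing_inv_mul _ hdet, conjTranspose_one]
    rw [mul_add, add_mul, mul_one, mul_assoc (L⁻¹)ᴴ, ← mul_assoc Lᴴ, h, one_mul, mul_assoc Y,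
      nonsing_inv_mul _ hdet, mul_one]
  rw [key, det_mul (_ * _) L, det_mul Lᴴ (_ + _), mul_right_comm, ← det_mul]
  exact le_mul_of_one_le_right hX.det_pos.le
    (hY.conjTranspose_mul_mul_same L⁻¹).one_le_det_one_add

/-- The Schur complement of a principal block of a positive definite matrix is positive
definite. -/
theorem PosDef.schur_complement {A : Matrix m m ℝ} {B : Matrix m n ℝ} {C : Matrix n m ℝ}
    {D : Matrix n n ℝ} [Invertible A] (h : (fromBlocks A B C D).PosDef) :
    (D - C * ⅟A * B).PosDef := by
  obtain ⟨-, rfl, -⟩ := isHermitian_fromBlocks_iff.1 h.1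
  have hA : A.PosDef := h.submatrix (e := Sum.inl) Sum.inl_injective
  have hS := (hA.fromBlocks₁₁ B D).1 h.posSemidef
  rw [← invOf_eq_nonsing_inv] at hS
  refine hS.posDef_iff_det_ne_zero.2 fun h0 => h.det_pos.ne' ?_
  rw [det_fromBlocks₁₁, h0, mul_zero]

/-- **Fischer's inequality**. -/
theorem PosDef.det_fromBlocks_le {A : Matrix m m ℝ} {B : Matrix m n ℝ} {C : Matrix n m ℝ}
    {D : Matrix n n ℝ} (h : (fromBlocks A B C D).PosDef) :
    (fromBlocks A B C D).det ≤ A.det * D.det := by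
  obtain ⟨-, rfl, -⟩ := isHermitian_fromBlocks_iff.1 h.1
  have hA : A.PosDef := h.submatrix (e := Sum.inl) Sum.inl_injective
  let : Invertible A := hA.isUnit.invertible
  rw [det_fromBlocks₁₁]
  refine mul_le_mul_of_nonneg_left ?_ hA.det_pos.le
  have hY := hA.inv.posSemidef.conjTranspose_mul_mul_same B
  rw [← invOf_eq_nonsing_inv] at hY
  simpa using h.schur_complement.det_le_det_add hY

theorem det_submatrix_sumMap_id {ι : Type*} (N : Matrix (p ⊕ ι) (p ⊕ ι) ℝ)
    [Invertible N.toBlocks₁₁] (f : n → ι) :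
    (N.submatrix (Sum.map id f) (Sum.map id f)).det = N.toBlocks₁₁.det *
      ((N.toBlocks₂₂ - N.toBlocks₂₁ * ⅟N.toBlocks₁₁ * N.toBlocks₁₂).submatrix f f).det := by
  have h : N.submatrix (Sum.map id f) (Sum.map id f) =
      fromBlocks N.toBlocks₁₁ (N.toBlocks₁₂.submatrix id f)
        (N.toBlocks₂₁.submatrix f id) (N.toBlocks₂₂.submatrix f f) := by
    ext (i | i) (j | j) <;> rfl
  rw [h, det_fromBlocks₁₁]
  rfl

/-- The Hadamard–Fischer inequality for a matrix partitioned into three blocks. -/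
theorem PosDef.det_mul_det_toBlocks₁₁_le {N : Matrix (p ⊕ (m ⊕ n)) (p ⊕ (m ⊕ n)) ℝ}
    (hN : N.PosDef) :
    N.det * N.toBlocks₁₁.det ≤
      (N.submatrix (Sum.map id Sum.inl) (Sum.map id Sum.inl)).det *
        (N.submatrix (Sum.map id Sum.inr) (Sum.map id Sum.inr)).det := by
  have hP : N.toBlocks₁₁.PosDef := hN.submatrix (e := Sum.inl) Sum.inl_injective
  let : Invertible N.toBlocks₁₁ := hP.isUnit.invertible
  have hS := PosDef.schur_complement (N.fromBlocks_toBlocks.symm ▸ hN)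
  have hdet := det_submatrix_sumMap_id N id
  rw [Sum.map_id_id, submatrix_id_id, submatrix_id_id] at hdet
  rw [det_submatrix_sumMap_id, det_submatrix_sumMap_id, hdet]
  set S := N.toBlocks₂₂ - N.toBlocks₂₁ * ⅟N.toBlocks₁₁ * N.toBlocks₁₂
  have hFischer : S.det ≤ S.toBlocks₁₁.det * S.toBlocks₂₂.det := by
    have h := hS
    rw [← S.fromBlocks_toBlocks] at h
    simpa only [fromBlocks_toBlocks] using h.det_fromBlocks_le
  calc N.toBlocks₁₁.det * S.det * N.toBlocks₁₁.det
      = N.toBlocks₁₁.det * N.toBlocks₁₁.det * S.det := by ring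
    _ ≤ N.toBlocks₁₁.det * N.toBlocks₁₁.det * (S.toBlocks₁₁.det * S.toBlocks₂₂.det) :=
        mul_le_mul_of_nonneg_left hFischer (mul_nonneg hP.det_pos.le hP.det_pos.le)
    _ = _ := mul_mul_mul_comm _ _ _ _

theorem det_submatrix_eq_of_range_eq {ι : Type*} (C : Matrix ι ι ℝ) {f : m → ι} {g : n → ι}
    (hf : f.Injective) (hg : g.Injective) (h : Set.range f = Set.range g) :
    (C.submatrix f f).det = (C.submatrix g g).det := by
  let e : m ≃ n := (Equiv.ofInjective f hf).trans ((Equiv.setCongr h).trans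
    (Equiv.ofInjective g hg).symm)
  have he : g ∘ e = f := funext fun i => by
    simp [e, Equiv.apply_ofInjective_symm]
  rw [← det_submatrix_equiv_self e (C.submatrix g g), submatrix_submatrix, he]

end Matrix

/-- Hadamard–Fischer inequality: for a real symmetric positive definite matrix `C` and
subsets `α, β` of the index set, `M(α)·M(β) ≥ M(α ∪ β)·M(α ∩ β)`, where `M(α)` is the
principal minor of `C` on the rows and columns indexed by `α` (with `M(∅) = 1`). -/
theorem hadamard_fischer (m : ℕ) (C : Matrix (Fin m) (Fin m) ℝ) (hC : C.PosDef)
    (M : Finset (Fin m) → ℝ)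
    (hM : ∀ s : Finset (Fin m), M s = (Matrix.of fun i j : {x // x ∈ s} => C i.1 j.1).det)
    (α β : Finset (Fin m)) :
    M α * M β ≥ M (α ∪ β) * M (α ∩ β) := by
  let v : {x // x ∈ α ∩ β} ⊕ ({x // x ∈ α \ β} ⊕ {x // x ∈ β \ α}) → Fin m :=
    Sum.elim Subtype.val (Sum.elim Subtype.val Subtype.val)
  have hv : v.Injective := by
    rintro (⟨i, hi⟩ | ⟨i, hi⟩ | ⟨i, hi⟩) (⟨j, hj⟩ | ⟨j, hj⟩ | ⟨j, hj⟩) hij <;> grind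
  have hM' : ∀ (s : Finset (Fin m)) {q : Type} [Fintype q] [DecidableEq q]
      (f : q → {x // x ∈ α ∩ β} ⊕ ({x // x ∈ α \ β} ⊕ {x // x ∈ β \ α})),
      f.Injective → Set.range (v ∘ f) = s →
      M s = ((C.submatrix v v).submatrix f f).det := by
    intro s q _ _ f hf hr
    rw [hM s, submatrix_submatrix]
    exact det_submatrix_eq_of_range_eq C Subtype.val_injective (hv.comp hf) (by simp [hr])
  rw [hM' (α ∪ β) id Function.injective_id, hM' (α ∩ β) Sum.inl Sum.inl_injective,
    hM' α (Sum.map id Sum.inl) (Function.injective_id.sumMap Sum.inl_injective),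
    hM' β (Sum.map id Sum.inr) (Function.injective_id.sumMap Sum.inr_injective)]
  · exact (hC.submatrix hv).det_mul_det_toBlocks₁₁_le
  all_goals
    ext x
    simp [v] <;> tauto
end

section
/- (Kolmogorov zero–one law for Gaussian product measures) Let b, a : ℕ → ℝ be sequences of positive reals, and let μ_b be the infinite product probability measure on ℝ^ℕ whose k-th factor is the centered Gaussian measure on ℝ with density √(b_k/π)·exp(−b_k x²) (i.e. mean 0 and variance 1/(2b_k)). Let l₂(a) = {x ∈ ℝ^ℕ : Σ_k a_k x_k² < ∞}. Then μ_b(l₂(a)) = 0 if Σ_k a_k/b_k = ∞, and μ_b(l₂(a)) = 1 if Σ_k a_k/b_k < ∞. -/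
open MeasureTheory ProbabilityTheory

open Filter Topology

/-- If `X` is centered Gaussian with variance `1 / (2b)`, then
`𝔼[exp (-a X²)] = 1 / √(1 + a / b)`. -/
lemma mgf_const_mul_sq_gaussianReal {a b : ℝ} (hb : 0 < b) :
    mgf (fun x ↦ a * x ^ 2) (gaussianReal 0 (1 / (2 * b)).toNNReal) (-1) =
      (√(1 + a / b))⁻¹ := by
  have hv : (1 / (2 * b)).toNNReal ≠ 0 := by
    rw [Ne, Real.toNNReal_eq_zero, not_le]
    positivity
  have hpdf (x : ℝ) : gaussianPDFReal 0 (1 / (2 * b)).toNNReal x • Real.exp (-1 * (a * x ^ 2)) =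
      (√(Real.pi / b))⁻¹ * Real.exp (-(b + a) * x ^ 2) := by
    rw [gaussianPDFReal_def, Real.coe_toNNReal _ (by positivity), smul_eq_mul, mul_assoc,
      ← Real.exp_add]
    congr 3
    · field
    · field_simp
      ring
  rw [mgf, integral_gaussianReal_eq_integral_smul hv]
  simp_rw [hpdf]
  rw [integral_const_mul, integral_gaussian, ← Real.sqrt_inv, ← Real.sqrt_inv,
    ← Real.sqrt_mul (by positivity)]
  congr 1
  rw [one_add_div hb.ne', inv_div, inv_div, div_mul_div_cancel₀ Real.pi_ne_zero]

lemma lintegral_ofReal_sq_gaussianReal (v : NNReal) :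
    ∫⁻ x, ENNReal.ofReal (x ^ 2) ∂gaussianReal 0 v = v := by
  have h := evariance_eq_lintegral_ofReal id (gaussianReal 0 v)
  simp only [id_eq, integral_id_gaussianReal, sub_zero] at h
  rw [← h, ← (memLp_id_gaussianReal 2).ofReal_variance_eq, variance_id_gaussianReal,
    ENNReal.ofReal_coe_nnreal]

lemma one_add_sum_le_prod_one_add_of_nonneg {ι : Type*} (s : Finset ι) {u : ι → ℝ}
    (hu : ∀ i, 0 ≤ u i) :
    1 + ∑ i ∈ s, u i ≤ ∏ i ∈ s, (1 + u i) := by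
  classical
  induction s using Finset.induction_on with
  | empty => simp
  | insert i s hi ih =>
    rw [Finset.sum_insert hi, Finset.prod_insert hi]
    nlinarith [hu i, mul_nonneg (hu i) (Finset.sum_nonneg fun j (_ : j ∈ s) ↦ hu j)]

lemma tendsto_prod_inv_sqrt_one_add {u : ℕ → ℝ} (hu : ∀ k, 0 ≤ u k) (hs : ¬ Summable u) :
    Tendsto (fun n ↦ ∏ k ∈ Finset.range n, (√(1 + u k))⁻¹) atTop (𝓝 0) := by
  have hsum := (not_summable_iff_tendsto_nat_atTop_of_nonneg hu).1 hs
  have hprod : Tendsto (fun n ↦ ∏ k ∈ Finset.range n, (1 + u k)) atTop atTop :=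
    tendsto_atTop_mono (fun n ↦ one_add_sum_le_prod_one_add_of_nonneg _ hu)
      (tendsto_atTop_add_const_left _ 1 hsum)
  refine (tendsto_inv_atTop_zero.comp (Real.tendsto_sqrt_atTop.comp hprod)).congr fun n ↦ ?_
  simp only [Function.comp_apply]
  rw [Real.sqrt_prod _ fun k _ ↦ add_nonneg zero_le_one (hu k), Finset.prod_inv_distrib]

/-- The weighted sum of squares is almost surely infinite as soon as `∑ aₖ / bₖ = ∞`. -/
lemma infinitePi_gaussianReal_summable_eq_zero {a b : ℕ → ℝ} (hb : ∀ k, 0 < b k)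
    (ha : ∀ k, 0 < a k) (hs : ¬ Summable fun k ↦ a k / b k) :
    Measure.infinitePi (fun k ↦ gaussianReal 0 (1 / (2 * b k)).toNNReal)
      {x : ℕ → ℝ | Summable fun k ↦ a k * x k ^ 2} = 0 := by
  set μ := Measure.infinitePi fun k ↦ gaussianReal 0 (1 / (2 * b k)).toNNReal
  set X : ℕ → (ℕ → ℝ) → ℝ := fun k x ↦ a k * x k ^ 2
  have hX (k : ℕ) : Measurable (X k) := by fun_prop
  have hX0 (k : ℕ) (x : ℕ → ℝ) : 0 ≤ X k x := mul_nonneg (ha k).le (sq_nonneg _)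
  have hmgf (n : ℕ) :
      mgf (∑ k ∈ Finset.range n, X k) μ (-1) = ∏ k ∈ Finset.range n, (√(1 + a k / b k))⁻¹ := by
    have hind : iIndepFun X μ :=
      iIndepFun_infinitePi (X := fun k (y : ℝ) ↦ a k * y ^ 2) fun k ↦ by fun_prop
    rw [hind.mgf_sum hX]
    refine Finset.prod_congr rfl fun k _ ↦ ?_
    rw [← mgf_const_mul_sq_gaussianReal (hb k),
      ← Measure.infinitePi_map_eval (fun k ↦ gaussianReal 0 (1 / (2 * b k)).toNNReal) k,
      mgf_map (X := fun y : ℝ ↦ a k * y ^ 2) (measurable_pi_apply k).aemeasurable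
        (by fun_prop)]
    rfl
  have hbound (M : ℕ) : μ {x | ∀ n, (∑ k ∈ Finset.range n, X k) x ≤ M} = 0 := by
    rw [← measureReal_eq_zero_iff]
    refine le_antisymm (ge_of_tendsto' (x := atTop) (f := fun n ↦
      Real.exp (M : ℝ) * ∏ k ∈ Finset.range n, (√(1 + a k / b k))⁻¹) ?_ fun n ↦ ?_)
      measureReal_nonneg
    · simpa using (tendsto_prod_inv_sqrt_one_add (fun k ↦ (div_pos (ha k) (hb k)).le) hs).const_mul
        (Real.exp (M : ℝ))
    · have hint : Integrable (fun x ↦ Real.exp (-1 * (∑ k ∈ Finset.range n, X k) x)) μ := by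
        refine Integrable.of_bound (by fun_prop) 1 (ae_of_all _ fun x ↦ ?_)
        rw [Real.norm_of_nonneg (Real.exp_nonneg _), Real.exp_le_one_iff, Finset.sum_apply]
        linarith [Finset.sum_nonneg fun k (_ : k ∈ Finset.range n) ↦ hX0 k x]
      calc μ.real {x | ∀ n, (∑ k ∈ Finset.range n, X k) x ≤ M}
          ≤ μ.real {x | (∑ k ∈ Finset.range n, X k) x ≤ M} := measureReal_mono fun x hx ↦ hx n
        _ ≤ _ := measure_le_le_exp_mul_mgf _ (by norm_num) hint
        _ = _ := by rw [hmgf, neg_neg, one_mul]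
  refine measure_mono_null (fun x hx ↦ ?_) (measure_iUnion_null hbound)
  obtain ⟨M, hM⟩ := exists_nat_ge (∑' k, X k x)
  refine Set.mem_iUnion.2 ⟨M, fun n ↦ ?_⟩
  rw [Finset.sum_apply]
  exact (Summable.sum_le_tsum _ (fun k _ ↦ hX0 k x) hx).trans hM

/-- The weighted sum of squares is almost surely finite as soon as `∑ aₖ / bₖ < ∞`. -/
lemma ae_summable_infinitePi_gaussianReal {a b : ℕ → ℝ} (ha : ∀ k, 0 < a k)
    (hs : Summable fun k ↦ a k / b k) :
    ∀ᵐ x ∂Measure.infinitePi (fun k ↦ gaussianReal 0 (1 / (2 * b k)).toNNReal),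
      Summable fun k ↦ a k * x k ^ 2 := by
  set μ := Measure.infinitePi fun k ↦ gaussianReal 0 (1 / (2 * b k)).toNNReal
  have hterm (k : ℕ) :
      ∫⁻ x : ℕ → ℝ, ENNReal.ofReal (a k * x k ^ 2) ∂μ = ENNReal.ofReal (a k / b k / 2) := by
    simp_rw [ENNReal.ofReal_mul (ha k).le]
    rw [lintegral_const_mul _ (by fun_prop),
      (measurePreserving_eval_infinitePi
        (fun k ↦ gaussianReal 0 (1 / (2 * b k)).toNNReal) k).lintegral_comp
        (f := fun y ↦ ENNReal.ofReal (y ^ 2)) (by fun_prop),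
      lintegral_ofReal_sq_gaussianReal, ← ENNReal.ofReal, ← ENNReal.ofReal_mul (ha k).le]
    congr 1
    field
  have hfin : ∫⁻ x : ℕ → ℝ, ∑' k, ENNReal.ofReal (a k * x k ^ 2) ∂μ ≠ ⊤ := by
    have hmeas (k : ℕ) : Measurable fun x : ℕ → ℝ ↦ ENNReal.ofReal (a k * x k ^ 2) := by
      fun_prop
    rw [lintegral_tsum fun k ↦ (hmeas k).aemeasurable]
    simp_rw [hterm]
    exact (hs.div_const 2).tsum_ofReal_ne_top
  filter_upwards [ae_lt_top (by fun_prop) hfin] with x hx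
  refine (ENNReal.summable_toReal hx.ne).congr fun k ↦ ?_
  exact ENNReal.toReal_ofReal (mul_nonneg (ha k).le (sq_nonneg _))

/-- Kolmogorov zero–one law for Gaussian product measures: if `μ` is the product over
`k ∈ ℕ` of the centered Gaussian measures with variance `1/(2bₖ)` (characterized by its
finite-dimensional marginals), then `μ(l₂(a)) = 0` if `Σ aₖ/bₖ = ∞` and `μ(l₂(a)) = 1`
if `Σ aₖ/bₖ < ∞`. -/
theorem kolmogorov_zero_one_gaussian
    (b a : ℕ → ℝ) (hb : ∀ k, 0 < b k) (ha : ∀ k, 0 < a k)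
    (μ : Measure (ℕ → ℝ)) [IsProbabilityMeasure μ]
    (hμ : ∀ s : Finset ℕ, μ.map (fun x (i : s) => x i) =
      Measure.pi fun i : s => gaussianReal 0 (Real.toNNReal (1 / (2 * b i)))) :
    (¬ Summable (fun k => a k / b k) →
      μ {x : ℕ → ℝ | Summable fun k => a k * x k ^ 2} = 0) ∧
    (Summable (fun k => a k / b k) →
      μ {x : ℕ → ℝ | Summable fun k => a k * x k ^ 2} = 1) := by
  have hμ_eq : μ = Measure.infinitePi fun k ↦ gaussianReal 0 (1 / (2 * b k)).toNNReal :=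
    IsProjectiveLimit.unique hμ (Measure.isProjectiveLimit_infinitePi _)
  subst hμ_eq
  refine ⟨infinitePi_gaussianReal_summable_eq_zero hb ha, fun hs ↦ ?_⟩
  rw [measure_congr (eventuallyEq_univ.2 (ae_summable_infinitePi_gaussianReal ha hs)),
    measure_univ]
end

section
/- Let b, a : ℤ → ℝ with b_n > 0 for all n, and let μ be the infinite product probability measure on ℝ^ℤ whose n-th factor is the Gaussian measure on ℝ with density √(b_n/π)·exp(−b_n(x−a_n)²) (mean a_n, variance 1/(2b_n)). For t ∈ ℝ, t ≠ 0, let μ^{L_t} be the pushforward of μ under the map x ↦ (t·x_n)_{n∈ℤ}. Then the following are equivalent: (i) μ^{L_t} and μ are mutually singular for every t ∉ {0,1}; (ii) μ^{L_{-1}} and μ are mutually singular; (iii) Σ_{n∈ℤ} 4·b_n·a_n² = ∞. -/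
open MeasureTheory ProbabilityTheory

open scoped ENNReal NNReal symmDiff

section ProductMeasures

/-- Two measures are mutually singular if they are concentrated, up to arbitrarily small error,
on complementary measurable sets. -/
lemma mutuallySingular_of_forall_exists_le {α : Type*} [MeasurableSpace α] {μ ν : Measure α}
    (h : ∀ ε : ℝ≥0∞, 0 < ε → ∃ A, μ A ≤ ε ∧ ν Aᶜ ≤ ε) : μ ⟂ₘ ν := by
  rw [Measure.mutuallySingular_iff_disjoint]
  intro ξ hμ hν
  suffices hξ : ξ Set.univ ≤ 0 from
    (Measure.measure_univ_eq_zero.1 (le_zero_iff.1 hξ)).le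
  refine le_of_forall_pos_le_add fun ε hε => ?_
  obtain ⟨A, hA, hA'⟩ := h (ε / 2) (ENNReal.half_pos hε.ne')
  calc ξ Set.univ = ξ (A ∪ Aᶜ) := by rw [Set.union_compl_self]
    _ ≤ ξ A + ξ Aᶜ := measure_union_le _ _
    _ ≤ ε / 2 + ε / 2 := add_le_add ((hμ A).trans hA) ((hν _).trans hA')
    _ = 0 + ε := by rw [ENNReal.add_halves, zero_add]

lemma lintegral_pi_prod {ι : Type*} [Fintype ι] (m : ι → Measure ℝ)
    [∀ i, IsProbabilityMeasure (m i)] {f : ι → ℝ → ℝ≥0∞} (hf : ∀ i, Measurable (f i)) :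
    ∫⁻ x, ∏ i, f i (x i) ∂(Measure.pi m) = ∏ i, ∫⁻ y, f i y ∂(m i) := by
  rw [lintegral_prod_eq_prod_lintegral_of_indepFun Finset.univ (fun i (x : ι → ℝ) => f i (x i))
    (iIndepFun_pi fun i => (hf i).aemeasurable) fun i => (hf i).comp (measurable_pi_apply i)]
  refine Finset.prod_congr rfl fun i _ => ?_
  exact (measurePreserving_eval m i).lintegral_comp (hf i)

lemma pi_withDensity {ι : Type*} [Fintype ι] (m : ι → Measure ℝ)
    [∀ i, IsProbabilityMeasure (m i)] {f : ι → ℝ → ℝ≥0∞} (hf : ∀ i, Measurable (f i))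
    [∀ i, IsProbabilityMeasure ((m i).withDensity (f i))] :
    Measure.pi (fun i => (m i).withDensity (f i)) =
      (Measure.pi m).withDensity fun x => ∏ i, f i (x i) := by
  refine Measure.pi_eq fun s hs => ?_
  rw [withDensity_apply _ (MeasurableSet.univ_pi hs),
    ← lintegral_indicator (MeasurableSet.univ_pi hs)]
  have h : (Set.univ.pi s).indicator (fun x : ι → ℝ => ∏ i, f i (x i)) =
      fun x => ∏ i, (s i).indicator (f i) (x i) := by
    ext x
    by_cases hx : x ∈ Set.univ.pi s
    · rw [Set.indicator_of_mem hx]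
      exact Finset.prod_congr rfl fun i _ => (Set.indicator_of_mem (hx i trivial) _).symm
    · rw [Set.indicator_of_notMem hx]
      obtain ⟨i, hi⟩ : ∃ i, x i ∉ s i := by simpa using hx
      exact (Finset.prod_eq_zero (Finset.mem_univ i) (Set.indicator_of_notMem hi _)).symm
  rw [h, lintegral_pi_prod m fun i => (hf i).indicator (hs i)]
  refine Finset.prod_congr rfl fun i _ => ?_
  rw [lintegral_indicator (hs i), withDensity_apply _ (hs i)]

lemma lintegral_prod_of_map_eq_pi {ι : Type*} {μ : Measure (ι → ℝ)} {m : ι → Measure ℝ}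
    [∀ i, IsProbabilityMeasure (m i)] {s : Finset ι}
    (hμ : μ.map (fun x (i : s) => x i) = Measure.pi fun i : s => m i)
    {f : ι → ℝ → ℝ≥0∞} (hf : ∀ i, Measurable (f i)) :
    ∫⁻ x, ∏ i ∈ s, f i (x i) ∂μ = ∏ i ∈ s, ∫⁻ y, f i y ∂(m i) := by
  rw [← Finset.prod_coe_sort s fun i => ∫⁻ y, f i y ∂(m i),
    ← lintegral_pi_prod (fun i : s => m i) fun i => hf i, ← hμ,
    lintegral_map (by fun_prop) (by fun_prop)]
  exact lintegral_congr fun x => (Finset.prod_coe_sort s fun i => f i (x i)).symm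

/-- If the affinities of the coordinates, bounded by means of test functions `φ` and `ψ`,
have products over finite sets that are arbitrarily small, then the two measures with
independent coordinates are mutually singular. -/
lemma mutuallySingular_of_prod_affinity {ι : Type*} {μ ν : Measure (ι → ℝ)}
    {m n : ι → Measure ℝ} [∀ i, IsProbabilityMeasure (m i)] [∀ i, IsProbabilityMeasure (n i)]
    (hμ : ∀ s : Finset ι, μ.map (fun x (i : s) => x i) = Measure.pi fun i : s => m i)
    (hν : ∀ s : Finset ι, ν.map (fun x (i : s) => x i) = Measure.pi fun i : s => n i)
    {φ ψ : ι → ℝ → ℝ≥0∞} (hφ : ∀ i, Measurable (φ i)) (hψ : ∀ i, Measurable (ψ i))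
    (hφψ : ∀ i x, 1 ≤ φ i x * ψ i x) {h : ι → ℝ≥0∞}
    (hm : ∀ i, ∫⁻ x, φ i x ∂(m i) ≤ h i) (hn : ∀ i, ∫⁻ x, ψ i x ∂(n i) ≤ h i)
    (hh : ∀ ε : ℝ≥0∞, 0 < ε → ∃ s : Finset ι, ∏ i ∈ s, h i ≤ ε) : μ ⟂ₘ ν := by
  refine mutuallySingular_of_forall_exists_le fun ε hε => ?_
  obtain ⟨s, hs⟩ := hh ε hε
  have bound : ∀ {ρ : Measure (ι → ℝ)} {r : ι → Measure ℝ} [∀ i, IsProbabilityMeasure (r i)]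
      {f : ι → ℝ → ℝ≥0∞}, (∀ i, Measurable (f i)) →
      ρ.map (fun x (i : s) => x i) = Measure.pi (fun i : s => r i) →
      (∀ i, ∫⁻ x, f i x ∂(r i) ≤ h i) → ρ {x | 1 ≤ ∏ i ∈ s, f i (x i)} ≤ ε := by
    intro ρ r _ f hf hρ hr
    calc ρ {x | 1 ≤ ∏ i ∈ s, f i (x i)} = 1 * ρ {x | 1 ≤ ∏ i ∈ s, f i (x i)} := (one_mul _).symm
      _ ≤ ∫⁻ x, ∏ i ∈ s, f i (x i) ∂ρ := mul_meas_ge_le_lintegral (by fun_prop) 1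
      _ = ∏ i ∈ s, ∫⁻ y, f i y ∂(r i) := lintegral_prod_of_map_eq_pi hρ hf
      _ ≤ ∏ i ∈ s, h i := Finset.prod_le_prod' fun i _ => hr i
      _ ≤ ε := hs
  refine ⟨_, bound hφ (hμ s) hm, (measure_mono fun x hx => ?_).trans (bound hψ (hν s) hn)⟩
  have hx' : ∏ i ∈ s, φ i (x i) ≤ 1 := le_of_not_ge hx
  calc (1 : ℝ≥0∞) ≤ ∏ i ∈ s, (φ i (x i) * ψ i (x i)) :=
        Finset.one_le_prod' fun i _ => hφψ i (x i)
    _ = (∏ i ∈ s, φ i (x i)) * ∏ i ∈ s, ψ i (x i) := Finset.prod_mul_distrib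
    _ ≤ ∏ i ∈ s, ψ i (x i) := mul_le_of_le_one_left' hx'

/-- Measures with independent coordinates are not mutually singular if the second moments of
the finite-dimensional densities are bounded. -/
lemma not_mutuallySingular_of_prod_sq_le {ι : Type*} {μ ν : Measure (ι → ℝ)}
    [IsProbabilityMeasure μ] [IsProbabilityMeasure ν]
    {m : ι → Measure ℝ} [∀ i, IsProbabilityMeasure (m i)]
    {f : ι → ℝ → ℝ≥0∞} [∀ i, IsProbabilityMeasure ((m i).withDensity (f i))]
    (hμ : ∀ s : Finset ι, μ.map (fun x (i : s) => x i) = Measure.pi fun i : s => m i)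
    (hν : ∀ s : Finset ι, ν.map (fun x (i : s) => x i) =
      Measure.pi fun i : s => (m i).withDensity (f i))
    (hf : ∀ i, Measurable (f i)) {K : ℝ≥0}
    (hK : ∀ s : Finset ι, ∏ i ∈ s, ∫⁻ x, f i x ^ 2 ∂(m i) ≤ K) : ¬ μ ⟂ₘ ν := by
  intro hsing
  obtain ⟨B, hB, hμB, hνB⟩ := hsing
  set M : ℝ≥0 := 4 * K + 1 with hM
  have hM0 : (0 : ℝ) < M := by rw [hM]; positivity
  set ε : ℝ := 1 / (4 * (M + 1)) with hε
  have hε0 : 0 < ε := by positivity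
  obtain ⟨C, hC, hBC⟩ := (Measure.MeasureDense.of_generateFrom_isSetAlgebra_finite (μ + ν)
    (isSetAlgebra_measurableCylinders (α := fun _ : ι => ℝ))
    generateFrom_measurableCylinders.symm).approx B hB (measure_ne_top _ _) ε hε0
  have hCm : MeasurableSet C := .of_mem_measurableCylinders hC
  have hμC : μ C ≤ ENNReal.ofReal ε :=
    calc μ C ≤ μ (B ∪ B ∆ C) := measure_mono fun x hx => by
            by_cases hxB : x ∈ B
            · exact Or.inl hxB
            · exact Or.inr (Or.inr ⟨hx, hxB⟩)
      _ ≤ μ B + μ (B ∆ C) := measure_union_le _ _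
      _ ≤ (μ + ν) (B ∆ C) := by rw [hμB, zero_add, Measure.add_apply]; exact le_self_add
      _ ≤ ENNReal.ofReal ε := hBC.le
  have hνC : ν Cᶜ ≤ ENNReal.ofReal ε :=
    calc ν Cᶜ ≤ ν (Bᶜ ∪ B ∆ C) := measure_mono fun x hx => by
            by_cases hxB : x ∈ B
            · exact Or.inr (Or.inl ⟨hxB, hx⟩)
            · exact Or.inl hxB
      _ ≤ ν Bᶜ + ν (B ∆ C) := measure_union_le _ _
      _ ≤ (μ + ν) (B ∆ C) := by rw [hνB, zero_add, Measure.add_apply]; exact le_add_self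
      _ ≤ ENNReal.ofReal ε := hBC.le
  have key : ν C ≤ M * μ C + (M : ℝ≥0∞)⁻¹ * K := by
    obtain ⟨s, S, hS, rfl⟩ := (mem_measurableCylinders C).1 hC
    have hr : Measurable fun (x : ι → ℝ) (i : s) => x i := by fun_prop
    have hμS : μ (cylinder s S) = Measure.pi (fun i : s => m i) S := by
      rw [← hμ, Measure.map_apply hr hS]; rfl
    have hνS : ν (cylinder s S) =
        ∫⁻ x in S, ∏ i : s, f i (x i) ∂Measure.pi (fun i : s => m i) := by
      rw [← withDensity_apply _ hS, ← pi_withDensity (fun i : s => m i) (fun i => hf i), ← hν,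
        Measure.map_apply hr hS]; rfl
    have hpt : ∀ F : ℝ≥0∞, F ≤ M + (M : ℝ≥0∞)⁻¹ * F ^ 2 := fun F => by
      rcases le_total F M with h | h
      · exact h.trans le_self_add
      · refine le_add_left ?_
        have hM' : (M : ℝ≥0∞) ≠ 0 := by exact_mod_cast hM0.ne'
        calc F = (M : ℝ≥0∞)⁻¹ * (M * F) := by
              rw [← mul_assoc, ENNReal.inv_mul_cancel hM' ENNReal.coe_ne_top, one_mul]
          _ ≤ (M : ℝ≥0∞)⁻¹ * F ^ 2 := by rw [sq]; gcongr
    rw [hμS, hνS]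
    calc ∫⁻ x in S, ∏ i : s, f i (x i) ∂Measure.pi (fun i : s => m i)
        ≤ ∫⁻ x in S, (M + (M : ℝ≥0∞)⁻¹ * (∏ i : s, f i (x i)) ^ 2) ∂Measure.pi (fun i : s => m i) :=
          lintegral_mono fun x => hpt _
      _ = M * Measure.pi (fun i : s => m i) S + (M : ℝ≥0∞)⁻¹ *
            ∫⁻ x in S, (∏ i : s, f i (x i)) ^ 2 ∂Measure.pi (fun i : s => m i) := by
          rw [lintegral_add_left measurable_const, setLIntegral_const,
            lintegral_const_mul _ (by fun_prop)]
      _ ≤ M * Measure.pi (fun i : s => m i) S + (M : ℝ≥0∞)⁻¹ * K := by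
          gcongr
          refine (setLIntegral_le_lintegral _ _).trans ?_
          simp_rw [← Finset.prod_pow]
          rw [lintegral_pi_prod (fun i : s => m i) (f := fun i x => f i x ^ 2)
            fun i => (hf i).pow_const 2]
          exact (Finset.prod_coe_sort s fun i => ∫⁻ x, f i x ^ 2 ∂(m i)).trans_le (hK s)
  have hone : (1 : ℝ≥0∞) ≤ ENNReal.ofReal (M * ε + (M : ℝ)⁻¹ * K + ε) :=
    calc (1 : ℝ≥0∞) = ν C + ν Cᶜ := by rw [measure_add_measure_compl hCm, measure_univ]
      _ ≤ (M * ENNReal.ofReal ε + (M : ℝ≥0∞)⁻¹ * K) + ENNReal.ofReal ε := by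
          refine add_le_add (key.trans ?_) hνC
          gcongr
      _ = ENNReal.ofReal (M * ε + (M : ℝ)⁻¹ * K + ε) := by
          rw [ENNReal.ofReal_add (by positivity) hε0.le,
            ENNReal.ofReal_add (by positivity) (by positivity),
            ENNReal.ofReal_mul (by positivity), ENNReal.ofReal_mul (by positivity),
            ENNReal.ofReal_inv_of_pos hM0]
          simp
  rw [ENNReal.one_le_ofReal] at hone
  have hK0 : (0 : ℝ) ≤ K := K.2
  have hMK : (M : ℝ) = 4 * K + 1 := by rw [hM]; push_cast; ring
  have h1 : (M : ℝ)⁻¹ * K ≤ 1 / 4 := by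
    rw [inv_mul_le_iff₀ hM0]; linarith
  have h2 : M * ε + ε = 1 / 4 := by rw [hε]; field_simp
  linarith

end ProductMeasures

section Gaussian

/-- The Hellinger affinity of the Gaussian measures with means `m₁`, `m₂` and
variances `v₁`, `v₂`. -/
noncomputable def gaussianAffinity (m₁ m₂ v₁ v₂ : ℝ) : ℝ :=
  √(2 * √(v₁ * v₂) / (v₁ + v₂)) * Real.exp (-(m₁ - m₂) ^ 2 / (4 * (v₁ + v₂)))

lemma gaussianAffinity_comm (m₁ m₂ v₁ v₂ : ℝ) :
    gaussianAffinity m₁ m₂ v₁ v₂ = gaussianAffinity m₂ m₁ v₂ v₁ := by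
  unfold gaussianAffinity
  rw [mul_comm v₁, add_comm v₁, ← neg_sub m₂ m₁, neg_sq]

lemma sqrt_gaussianPDFReal_mul (m₁ m₂ : ℝ) {v₁ v₂ : ℝ≥0} (h₁ : v₁ ≠ 0) (h₂ : v₂ ≠ 0) (x : ℝ) :
    √(gaussianPDFReal m₁ v₁ x * gaussianPDFReal m₂ v₂ x) = gaussianAffinity m₁ m₂ v₁ v₂ *
      gaussianPDFReal ((v₂ * m₁ + v₁ * m₂) / (v₁ + v₂)) (2 * v₁ * v₂ / (v₁ + v₂)) x := by
  have p₁ : (0 : ℝ) < v₁ := by exact_mod_cast h₁.bot_lt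
  have p₂ : (0 : ℝ) < v₂ := by exact_mod_cast h₂.bot_lt
  have hA : 0 ≤ gaussianAffinity m₁ m₂ v₁ v₂ := by unfold gaussianAffinity; positivity
  rw [← Real.sqrt_sq (mul_nonneg hA (gaussianPDFReal_nonneg _ _ x))]
  congr 1
  have hs : √((v₁ : ℝ) * v₂) ^ 2 = v₁ * v₂ := Real.sq_sqrt (by positivity)
  have hs0 : 0 < √((v₁ : ℝ) * v₂) := by positivity
  have hc : (√(2 * Real.pi * v₁))⁻¹ * (√(2 * Real.pi * v₂))⁻¹ =
      (2 * Real.pi * √((v₁ : ℝ) * v₂))⁻¹ := by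
    rw [← mul_inv, ← Real.sqrt_mul (by positivity),
      show 2 * Real.pi * (v₁ : ℝ) * (2 * Real.pi * v₂) = (2 * Real.pi) ^ 2 * (v₁ * v₂) by ring,
      Real.sqrt_mul (by positivity), Real.sqrt_sq (by positivity)]
  have hc' : 2 * √((v₁ : ℝ) * v₂) / (v₁ + v₂) * (2 * Real.pi * (2 * v₁ * v₂ / (v₁ + v₂)))⁻¹ =
      (2 * Real.pi * √((v₁ : ℝ) * v₂))⁻¹ := by
    field_simp
    linear_combination hs
  rw [gaussianPDFReal_def, gaussianPDFReal_def, gaussianPDFReal_def, gaussianAffinity]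
  push_cast
  rw [mul_pow, mul_pow, mul_pow, inv_pow, Real.sq_sqrt (by positivity), Real.sq_sqrt (by positivity),
    mul_mul_mul_comm, mul_mul_mul_comm (2 * √((v₁ : ℝ) * v₂) / (v₁ + v₂)), hc, hc',
    ← Real.exp_nat_mul, ← Real.exp_nat_mul, ← Real.exp_add, ← Real.exp_add]
  congr 2
  push_cast
  field_simp
  ring

lemma lintegral_sqrt_div_gaussianPDFReal (m₁ m₂ : ℝ) {v₁ v₂ : ℝ≥0} (h₁ : v₁ ≠ 0) (h₂ : v₂ ≠ 0) :
    ∫⁻ x, ENNReal.ofReal √(gaussianPDFReal m₂ v₂ x / gaussianPDFReal m₁ v₁ x)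
      ∂(gaussianReal m₁ v₁) = ENNReal.ofReal (gaussianAffinity m₁ m₂ v₁ v₂) := by
  have hw : 2 * v₁ * v₂ / (v₁ + v₂) ≠ 0 := by positivity
  rw [gaussianReal_of_var_ne_zero _ h₁,
    lintegral_withDensity_eq_lintegral_mul _ (measurable_gaussianPDF _ _) (by fun_prop)]
  have h : ∀ x, (gaussianPDF m₁ v₁ * fun x =>
      ENNReal.ofReal √(gaussianPDFReal m₂ v₂ x / gaussianPDFReal m₁ v₁ x)) x =
      ENNReal.ofReal (gaussianAffinity m₁ m₂ v₁ v₂) *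
        gaussianPDF ((v₂ * m₁ + v₁ * m₂) / (v₁ + v₂)) (2 * v₁ * v₂ / (v₁ + v₂)) x := fun x => by
    have hp := gaussianPDFReal_pos m₁ v₁ x h₁
    rw [Pi.mul_apply, gaussianPDF_def, gaussianPDF_def, ← ENNReal.ofReal_mul hp.le,
      ← ENNReal.ofReal_mul (by unfold gaussianAffinity; positivity),
      ← sqrt_gaussianPDFReal_mul m₁ m₂ h₁ h₂]
    congr 1
    nth_rw 1 [← Real.sqrt_sq hp.le]
    rw [← Real.sqrt_mul (by positivity)]
    congr 1
    field_simp
  rw [lintegral_congr h, lintegral_const_mul _ (measurable_gaussianPDF _ _),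
    lintegral_gaussianPDF_eq_one _ hw, mul_one]

lemma mutuallySingular_of_prod_gaussianAffinity {ι : Type*} {μ ν : Measure (ι → ℝ)}
    {m n : ι → ℝ} {v w : ι → ℝ≥0} (hv : ∀ i, v i ≠ 0) (hw : ∀ i, w i ≠ 0)
    (hμ : ∀ s : Finset ι, μ.map (fun x (i : s) => x i) =
      Measure.pi fun i : s => gaussianReal (m i) (v i))
    (hν : ∀ s : Finset ι, ν.map (fun x (i : s) => x i) =
      Measure.pi fun i : s => gaussianReal (n i) (w i))
    (hh : ∀ ε : ℝ, 0 < ε →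
      ∃ s : Finset ι, ∏ i ∈ s, gaussianAffinity (m i) (n i) (v i) (w i) ≤ ε) : μ ⟂ₘ ν := by
  refine mutuallySingular_of_prod_affinity (m := fun i => gaussianReal (m i) (v i))
    (n := fun i => gaussianReal (n i) (w i)) hμ hν
    (φ := fun i x => ENNReal.ofReal
      √(gaussianPDFReal (n i) (w i) x / gaussianPDFReal (m i) (v i) x))
    (ψ := fun i x => ENNReal.ofReal
      √(gaussianPDFReal (m i) (v i) x / gaussianPDFReal (n i) (w i) x))
    (h := fun i => ENNReal.ofReal (gaussianAffinity (m i) (n i) (v i) (w i)))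
    (fun i => by fun_prop) (fun i => by fun_prop) (fun i x => ?_)
    (fun i => (lintegral_sqrt_div_gaussianPDFReal _ _ (hv i) (hw i)).le)
    (fun i => ?_) (fun ε hε => ?_)
  · have hp := gaussianPDFReal_pos (m i) (v i) x (hv i)
    have hq := gaussianPDFReal_pos (n i) (w i) x (hw i)
    rw [← ENNReal.ofReal_mul (by positivity), ← Real.sqrt_mul (by positivity),
      div_mul_div_cancel₀ hp.ne', div_self hq.ne', Real.sqrt_one, ENNReal.ofReal_one]
  · rw [lintegral_sqrt_div_gaussianPDFReal _ _ (hw i) (hv i), gaussianAffinity_comm]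
  · rcases eq_or_ne ε ∞ with rfl | hε'
    · exact ⟨∅, le_top⟩
    · obtain ⟨s, hs⟩ := hh ε.toReal (ENNReal.toReal_pos hε.ne' hε')
      refine ⟨s, ?_⟩
      rw [← ENNReal.ofReal_prod_of_nonneg fun i _ => by unfold gaussianAffinity; positivity]
      exact ENNReal.ofReal_le_of_le_toReal hs

lemma gaussianReal_neg_eq_withDensity (m : ℝ) {v : ℝ≥0} (hv : v ≠ 0) :
    gaussianReal (-m) v =
      (gaussianReal m v).withDensity fun x => ENNReal.ofReal (Real.exp (-2 * m / v * x)) := by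
  have hv' : (v : ℝ) ≠ 0 := by exact_mod_cast hv
  rw [gaussianReal_of_var_ne_zero _ hv, gaussianReal_of_var_ne_zero _ hv,
    ← withDensity_mul _ (measurable_gaussianPDF _ _) (by fun_prop)]
  congr 1
  ext x
  rw [Pi.mul_apply, gaussianPDF_def, gaussianPDF_def,
    ← ENNReal.ofReal_mul (gaussianPDFReal_nonneg _ _ _), gaussianPDFReal_def, gaussianPDFReal_def]
  dsimp only
  rw [mul_assoc (√(2 * Real.pi * v))⁻¹, ← Real.exp_add]
  congr 3
  field_simp
  ring

lemma lintegral_exp_mul_gaussianReal (m : ℝ) (v : ℝ≥0) (t : ℝ) :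
    ∫⁻ x, ENNReal.ofReal (Real.exp (t * x)) ∂(gaussianReal m v) =
      ENNReal.ofReal (Real.exp (m * t + v * t ^ 2 / 2)) := by
  rw [← ofReal_integral_eq_lintegral_ofReal (integrable_exp_mul_gaussianReal t)
    (Filter.Eventually.of_forall fun x => (Real.exp_pos _).le)]
  congr 1
  exact congrFun mgf_id_gaussianReal t

lemma map_const_mul_eq_pi_gaussianReal {ι : Type*} {μ : Measure (ι → ℝ)} {m : ι → ℝ}
    {v : ι → ℝ≥0} {s : Finset ι}
    (hμ : μ.map (fun x (i : s) => x i) = Measure.pi fun i : s => gaussianReal (m i) (v i))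
    (t : ℝ) :
    (μ.map fun (x : ι → ℝ) n => t * x n).map (fun x (i : s) => x i) =
      Measure.pi fun i : s => gaussianReal (t * m i) (.mk (t ^ 2) (sq_nonneg _) * v i) := by
  have h : (fun (x : ι → ℝ) (i : s) => x i) ∘ (fun (x : ι → ℝ) n => t * x n) =
      (fun (y : s → ℝ) i => t * y i) ∘ fun x (i : s) => x i := rfl
  have hp : ∀ i : s, IsProbabilityMeasure ((gaussianReal (m i) (v i)).map (t * ·)) := fun i =>
    Measure.isProbabilityMeasure_map (by fun_prop)
  rw [Measure.map_map (by fun_prop) (by fun_prop), h, ← Measure.map_map (by fun_prop) (by fun_prop),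
    hμ, Measure.pi_map_pi (f := fun _ x => t * x) fun i => by fun_prop]
  simp_rw [gaussianReal_map_const_mul]

lemma mutuallySingular_map_const_mul {ι : Type*} {μ : Measure (ι → ℝ)} {m : ι → ℝ} {v : ι → ℝ≥0}
    (hv : ∀ i, v i ≠ 0)
    (hμ : ∀ s : Finset ι, μ.map (fun x (i : s) => x i) =
      Measure.pi fun i : s => gaussianReal (m i) (v i)) {t : ℝ} (ht : t ≠ 0)
    (hh : ∀ ε : ℝ, 0 < ε →
      ∃ s : Finset ι, ∏ i ∈ s, gaussianAffinity (m i) (t * m i) (v i) (t ^ 2 * v i) ≤ ε) :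
    (μ.map fun x n => t * x n) ⟂ₘ μ := by
  have hw : ∀ i, NNReal.mk (t ^ 2) (sq_nonneg t) * v i ≠ 0 := fun i => by
    rw [← NNReal.coe_ne_zero, NNReal.coe_mul, NNReal.coe_mk]
    exact mul_ne_zero (pow_ne_zero 2 ht) (NNReal.coe_ne_zero.2 (hv i))
  refine (mutuallySingular_of_prod_gaussianAffinity (n := fun i => t * m i) hv hw hμ
    (fun s => map_const_mul_eq_pi_gaussianReal (hμ s) t) ?_).symm
  simpa only [NNReal.coe_mul, NNReal.coe_mk] using hh

lemma mutuallySingular_map_const_mul_of_sq_ne_one {ι : Type*} [Infinite ι] {μ : Measure (ι → ℝ)}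
    {m : ι → ℝ} {v : ι → ℝ≥0} (hv : ∀ i, v i ≠ 0)
    (hμ : ∀ s : Finset ι, μ.map (fun x (i : s) => x i) =
      Measure.pi fun i : s => gaussianReal (m i) (v i)) {t : ℝ} (ht : t ≠ 0) (ht1 : t ^ 2 ≠ 1) :
    (μ.map fun x n => t * x n) ⟂ₘ μ := by
  refine mutuallySingular_map_const_mul hv hμ ht fun ε hε => ?_
  set r : ℝ := √(2 * |t| / (1 + t ^ 2)) with hr
  have hr1 : r < 1 := by
    rw [hr, Real.sqrt_lt' one_pos, one_pow, div_lt_one (by positivity)]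
    have h1 : |t| ≠ 1 := fun h => ht1 (by rw [← sq_abs, h, one_pow])
    have h2 : 0 < (|t| - 1) ^ 2 := by
      have := sub_ne_zero.2 h1
      positivity
    nlinarith [sq_abs t]
  have haff : ∀ i, gaussianAffinity (m i) (t * m i) (v i) (t ^ 2 * v i) ≤ r := by
    intro i
    have h0 : (0 : ℝ) < v i := by exact_mod_cast (hv i).bot_lt
    have h3 : √((v i : ℝ) * (t ^ 2 * v i)) = |t| * v i := by
      rw [show (v i : ℝ) * (t ^ 2 * v i) = (|t| * v i) ^ 2 by rw [mul_pow, sq_abs]; ring,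
        Real.sqrt_sq (by positivity)]
    have h4 : 2 * (|t| * v i) / (v i + t ^ 2 * v i) = 2 * |t| / (1 + t ^ 2) := by
      field_simp
    unfold gaussianAffinity
    rw [h3, h4]
    refine mul_le_of_le_one_right (Real.sqrt_nonneg _) (Real.exp_le_one_iff.2 ?_)
    rw [neg_div]
    exact neg_nonpos.2 (by positivity)
  obtain ⟨k, hk⟩ := exists_pow_lt_of_lt_one hε hr1
  obtain ⟨s, hs⟩ := Infinite.exists_subset_card_eq ι k
  refine ⟨s, (Finset.prod_le_prod (fun i _ => ?_) fun i _ => haff i).trans ?_⟩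
  · unfold gaussianAffinity
    positivity
  · rw [Finset.prod_const, hs]
    exact hk.le

lemma mutuallySingular_map_neg_of_not_summable {ι : Type*} {μ : Measure (ι → ℝ)}
    {m : ι → ℝ} {v : ι → ℝ≥0} (hv : ∀ i, v i ≠ 0)
    (hμ : ∀ s : Finset ι, μ.map (fun x (i : s) => x i) =
      Measure.pi fun i : s => gaussianReal (m i) (v i))
    (hsum : ¬ Summable fun i => m i ^ 2 / v i) :
    (μ.map fun x n => (-1 : ℝ) * x n) ⟂ₘ μ := by
  refine mutuallySingular_map_const_mul hv hμ (by norm_num) fun ε hε => ?_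
  have haff : ∀ i, gaussianAffinity (m i) (-1 * m i) (v i) ((-1) ^ 2 * v i) =
      Real.exp (-(1 / 2 * (m i ^ 2 / v i))) := by
    intro i
    have h0 : (0 : ℝ) < v i := by exact_mod_cast (hv i).bot_lt
    unfold gaussianAffinity
    rw [neg_one_sq, one_mul, Real.sqrt_mul_self h0.le, ← two_mul, div_self (by positivity),
      Real.sqrt_one, one_mul]
    congr 1
    field_simp
    ring
  simp_rw [haff, ← Real.exp_sum]
  by_contra! hcon
  refine hsum (summable_of_sum_le (c := -2 * Real.log ε) (fun i => by positivity) fun s => ?_)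
  have := (Real.log_lt_iff_lt_exp hε).2 (hcon s)
  rw [Finset.sum_neg_distrib, ← Finset.mul_sum] at this
  linarith

lemma not_mutuallySingular_map_neg_of_summable {ι : Type*} {μ : Measure (ι → ℝ)}
    [IsProbabilityMeasure μ] {m : ι → ℝ} {v : ι → ℝ≥0} (hv : ∀ i, v i ≠ 0)
    (hμ : ∀ s : Finset ι, μ.map (fun x (i : s) => x i) =
      Measure.pi fun i : s => gaussianReal (m i) (v i))
    (hsum : Summable fun i => m i ^ 2 / v i) :
    ¬ (μ.map fun x n => (-1 : ℝ) * x n) ⟂ₘ μ := by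
  intro hsing
  have : IsProbabilityMeasure (μ.map fun (x : ι → ℝ) n => (-1 : ℝ) * x n) :=
    Measure.isProbabilityMeasure_map (Measurable.aemeasurable (by fun_prop))
  have hprob : ∀ i, IsProbabilityMeasure ((gaussianReal (m i) (v i)).withDensity
      fun x => ENNReal.ofReal (Real.exp (-2 * m i / v i * x))) := fun i => by
    rw [← gaussianReal_neg_eq_withDensity _ (hv i)]
    infer_instance
  refine not_mutuallySingular_of_prod_sq_le (m := fun i => gaussianReal (m i) (v i))
    (f := fun i x => ENNReal.ofReal (Real.exp (-2 * m i / v i * x))) hμ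
    (fun s => ?_) (fun i => by fun_prop)
    (K := Real.toNNReal (Real.exp (4 * ∑' i, m i ^ 2 / v i))) (fun s => ?_) hsing.symm
  · rw [map_const_mul_eq_pi_gaussianReal (hμ s)]
    congr 1
    ext1 i
    rw [← gaussianReal_neg_eq_withDensity _ (hv i), neg_one_mul]
    congr 1
    ext
    simp
  · have hsq : ∀ i, ∫⁻ x, ENNReal.ofReal (Real.exp (-2 * m i / v i * x)) ^ 2
        ∂(gaussianReal (m i) (v i)) = ENNReal.ofReal (Real.exp (4 * (m i ^ 2 / v i))) := by
      intro i
      have h0 : (0 : ℝ) < v i := by exact_mod_cast (hv i).bot_lt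
      simp_rw [← ENNReal.ofReal_pow (Real.exp_pos _).le, ← Real.exp_nat_mul, ← mul_assoc]
      rw [lintegral_exp_mul_gaussianReal]
      congr 2
      push_cast
      field_simp
      ring
    simp_rw [hsq]
    rw [← ENNReal.ofReal_prod_of_nonneg fun i _ => (Real.exp_pos _).le, ← Real.exp_sum,
      ← Finset.mul_sum]
    refine ENNReal.ofReal_le_ofReal (Real.exp_le_exp.2 ?_)
    gcongr
    exact hsum.sum_le_tsum s fun i _ => by positivity

end Gaussian

/-- For the product over `n ∈ ℤ` of Gaussian measures with mean `aₙ` and variance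
`1/(2bₙ)` (characterized by its finite-dimensional marginals), the following are
equivalent: (i) `μ^{L_t} ⟂ μ` for every `t ∉ {0,1}`; (ii) `μ^{L_{-1}} ⟂ μ`;
(iii) `Σ 4bₙaₙ² = ∞`. -/
theorem scaling_singular_iff (b a : ℤ → ℝ) (hb : ∀ n, 0 < b n)
    (μ : Measure (ℤ → ℝ)) [IsProbabilityMeasure μ]
    (hμ : ∀ s : Finset ℤ, μ.map (fun x (i : s) => x i) =
      Measure.pi fun i : s => gaussianReal (a i) (Real.toNNReal (1 / (2 * b i)))) :
    ((∀ t : ℝ, t ≠ 0 → t ≠ 1 → (μ.map fun x n => t * x n) ⟂ₘ μ) ↔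
        (μ.map fun x n => (-1 : ℝ) * x n) ⟂ₘ μ) ∧
    (((μ.map fun x n => (-1 : ℝ) * x n) ⟂ₘ μ) ↔
        ¬ Summable fun n : ℤ => 4 * b n * a n ^ 2) := by
  have hvpos : ∀ n, 0 < 1 / (2 * b n) := fun n => by have := hb n; positivity
  have hv : ∀ n, Real.toNNReal (1 / (2 * b n)) ≠ 0 := fun n => (Real.toNNReal_pos.2 (hvpos n)).ne'
  have hsum : (Summable fun n : ℤ => 4 * b n * a n ^ 2) ↔
      Summable fun n => a n ^ 2 / (Real.toNNReal (1 / (2 * b n)) : ℝ) := by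
    rw [← summable_mul_left_iff (two_ne_zero (α := ℝ)) (f := fun n => a n ^ 2 / _)]
    refine summable_congr fun n => ?_
    have := (hb n).ne'
    rw [Real.coe_toNNReal _ (hvpos n).le]
    field_simp
    ring
  rw [hsum]
  refine ⟨⟨fun h => h (-1) (by norm_num) (by norm_num), fun h t ht ht1 => ?_⟩,
    fun h h' => not_mutuallySingular_map_neg_of_summable hv hμ h' h,
    mutuallySingular_map_neg_of_not_summable hv hμ⟩
  by_cases h2 : t ^ 2 = 1
  · rcases mul_self_eq_one_iff.1 (sq t ▸ h2) with rfl | rfl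
    · exact absurd rfl ht1
    · exact h
  · exact mutuallySingular_map_const_mul_of_sq_ne_one hv hμ ht h2
end

section
/- Let b₁, b₂ : ℤ → ℝ be positive sequences and let μ be the infinite product probability measure on (ℝ²)^ℤ whose n-th factor is the product of the centered Gaussian measures on ℝ with variances 1/(2b₁(n)) and 1/(2b₂(n)) respectively. For an invertible real 2×2 matrix t = (t_{rs}), let μ^{L_t} be the pushforward of μ under the map applying t to every coordinate: x ↦ (t·x_n)_{n∈ℤ}. If det t > 0, then μ^{L_t} ⊥ μ if and only if Σ_{n∈ℤ} [(1 − |det t|)² + (t₁₁ − t₂₂)² + (t₁₂·√(b₁(n)/b₂(n)) + t₂₁·√(b₂(n)/b₁(n)))²] = ∞. If det t < 0, then μ^{L_t} ⊥ μ if and only if Σ_{n∈ℤ} [(1 − |det t|)² + (t₁₁ + t₂₂)² + (t₁₂·√(b₁(n)/b₂(n)) − t₂₁·√(b₂(n)/b₁(n)))²] = ∞. -/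
open MeasureTheory ProbabilityTheory Matrix
open scoped ENNReal

namespace MeasureTheory

theorem lintegral_fin_prod_eq_prod {n : ℕ} {E : Fin n → Type*} {mE : ∀ i, MeasurableSpace (E i)}
    {μ : (i : Fin n) → Measure (E i)} [∀ i, SigmaFinite (μ i)] {f : (i : Fin n) → E i → ℝ≥0∞}
    (hf : ∀ i, Measurable (f i)) :
    ∫⁻ x, ∏ i, f i (x i) ∂(Measure.pi μ) = ∏ i, ∫⁻ x, f i x ∂(μ i) := by
  induction n with
  | zero => simp
  | succ n ih =>
    have h := (measurePreserving_piFinSuccAbove μ 0).lintegral_comp_emb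
      (MeasurableEquiv.measurableEmbedding _)
      fun x : E 0 × (∀ i : Fin n, E i.succ) => f 0 x.1 * ∏ i : Fin n, f i.succ (x.2 i)
    rw [Fin.prod_univ_succ, ← ih fun i => hf i.succ, ← lintegral_prod_mul (hf 0).aemeasurable
      (Finset.measurable_fun_prod _ fun i _ =>
        (hf i.succ).comp (measurable_pi_apply i)).aemeasurable]
    exact (lintegral_congr fun x => Fin.prod_univ_succ _).trans h

theorem lintegral_fintype_prod_eq_prod {ι : Type*} [Fintype ι] {E : ι → Type*}
    {mE : ∀ i, MeasurableSpace (E i)} {μ : (i : ι) → Measure (E i)} [∀ i, SigmaFinite (μ i)]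
    {f : (i : ι) → E i → ℝ≥0∞} (hf : ∀ i, Measurable (f i)) :
    ∫⁻ x, ∏ i, f i (x i) ∂(Measure.pi μ) = ∏ i, ∫⁻ x, f i x ∂(μ i) := by
  let e := (Fintype.equivFin ι).symm
  rw [← (measurePreserving_piCongrLeft _ e).lintegral_comp_emb
    (MeasurableEquiv.measurableEmbedding _)]
  simp_rw [← e.prod_comp, MeasurableEquiv.coe_piCongrLeft, Equiv.piCongrLeft_apply_apply]
  exact lintegral_fin_prod_eq_prod fun i => hf (e i)

theorem Measure.pi_withDensity {ι : Type*} [Fintype ι] {E : ι → Type*}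
    {mE : ∀ i, MeasurableSpace (E i)} {μ : (i : ι) → Measure (E i)} [∀ i, SigmaFinite (μ i)]
    {f : (i : ι) → E i → ℝ≥0∞} (hf : ∀ i, Measurable (f i))
    [∀ i, SigmaFinite ((μ i).withDensity (f i))] :
    Measure.pi (fun i => (μ i).withDensity (f i)) =
      (Measure.pi μ).withDensity fun x => ∏ i, f i (x i) := by
  refine Measure.pi_eq fun s hs => ?_
  rw [withDensity_apply _ (.univ_pi hs), ← lintegral_indicator (.univ_pi hs)]
  simp_rw [withDensity_apply _ (hs _), ← lintegral_indicator (hs _)]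
  rw [← lintegral_fintype_prod_eq_prod fun i => (hf i).indicator (hs i)]
  refine lintegral_congr fun x => ?_
  by_cases hx : x ∈ Set.univ.pi s
  · simp only [Set.indicator_of_mem hx]
    exact Finset.prod_congr rfl fun i _ => (Set.indicator_of_mem (hx i trivial) _).symm
  · rw [Set.indicator_of_notMem hx]
    obtain ⟨i, hi⟩ : ∃ i, x i ∉ s i := by simpa using hx
    exact (Finset.prod_eq_zero (Finset.mem_univ i) (Set.indicator_of_notMem hi _)).symm

/-- Two measures are mutually singular as soon as they are almost carried by complementary sets,
up to an arbitrarily small error. -/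
theorem Measure.MutuallySingular.of_forall_exists_lt {α : Type*} {mα : MeasurableSpace α}
    {μ ν : Measure α} (h : ∀ ε : ℝ≥0∞, ε ≠ 0 → ∃ t, μ t + ν tᶜ < ε) : μ ⟂ₘ ν := by
  refine mutuallySingular_of_disjoint fun κ hκμ hκν => ?_
  have hκ : κ Set.univ = 0 := by
    by_contra hne
    obtain ⟨t, ht⟩ := h _ hne
    refine ht.not_ge ?_
    rw [← Set.union_compl_self t]
    exact (measure_union_le _ _).trans (add_le_add (hκμ t) (hκν tᶜ))
  exact (Measure.measure_univ_eq_zero.1 hκ).le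

section affinity

variable {α : Type*} {mα : MeasurableSpace α} {μ : Measure α} {f g : α → ℝ≥0∞}

theorem setLIntegral_sqrt_mul_le (hf : Measurable f) (hg : Measurable g) (A : Set α) :
    ∫⁻ x in A, (f x * g x) ^ (1 / 2 : ℝ) ∂μ ≤
      (∫⁻ x in A, f x ∂μ) ^ (1 / 2 : ℝ) * (∫⁻ x in A, g x ∂μ) ^ (1 / 2 : ℝ) := by
  have h := ENNReal.lintegral_mul_le_Lp_mul_Lq (μ.restrict A) Real.HolderConjugate.two_two
    (hf.pow_const (1 / 2 : ℝ)).aemeasurable (hg.pow_const (1 / 2 : ℝ)).aemeasurable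
  have h_sq (a : ℝ≥0∞) : (a ^ (1 / 2 : ℝ)) ^ (2 : ℝ) = a := by rw [← ENNReal.rpow_mul]; norm_num
  simpa only [h_sq, Pi.mul_apply,
    ← ENNReal.mul_rpow_of_nonneg _ _ (by norm_num : (0 : ℝ) ≤ 1 / 2)] using h

/-- The Hellinger affinity of two measures is small if they are almost carried by
complementary sets. -/
theorem lintegral_sqrt_mul_le (hf : Measurable f) (hg : Measurable g)
    [IsProbabilityMeasure (μ.withDensity f)] [IsProbabilityMeasure (μ.withDensity g)]
    {A : Set α} (hA : MeasurableSet A) :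
    ∫⁻ x, (f x * g x) ^ (1 / 2 : ℝ) ∂μ ≤
      (μ.withDensity f A) ^ (1 / 2 : ℝ) + (μ.withDensity g Aᶜ) ^ (1 / 2 : ℝ) := by
  rw [← lintegral_add_compl _ hA]
  refine add_le_add ?_ ?_
  · refine (setLIntegral_sqrt_mul_le hf hg A).trans ?_
    rw [← withDensity_apply _ hA, ← withDensity_apply _ hA]
    exact mul_le_of_le_one_right' (ENNReal.rpow_le_one prob_le_one (by norm_num))
  · refine (setLIntegral_sqrt_mul_le hf hg Aᶜ).trans ?_
    rw [← withDensity_apply _ hA.compl, ← withDensity_apply _ hA.compl]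
    exact mul_le_of_le_one_left' (ENNReal.rpow_le_one prob_le_one (by norm_num))

/-- The set where one density is smaller than the other almost separates two measures with small
Hellinger affinity. -/
theorem exists_withDensity_add_compl_le (hf : Measurable f) (hg : Measurable g) :
    ∃ A, MeasurableSet A ∧ μ.withDensity f A + μ.withDensity g Aᶜ ≤
      ∫⁻ x, (f x * g x) ^ (1 / 2 : ℝ) ∂μ := by
  have h_le {a b : ℝ≥0∞} (h : a ≤ b) : a ≤ (a * b) ^ (1 / 2 : ℝ) := by
    calc a = (a * a) ^ (1 / 2 : ℝ) := by
          rw [← sq, ← ENNReal.rpow_natCast, ← ENNReal.rpow_mul]; norm_num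
      _ ≤ _ := ENNReal.rpow_le_rpow (by gcongr) (by norm_num)
  have hA : MeasurableSet {x | f x ≤ g x} := measurableSet_le hf hg
  refine ⟨_, hA, ?_⟩
  rw [withDensity_apply _ hA, withDensity_apply _ hA.compl,
    ← lintegral_add_compl (fun x => (f x * g x) ^ (1 / 2 : ℝ)) hA]
  refine add_le_add (setLIntegral_mono' hA fun x hx => h_le hx)
    (setLIntegral_mono' hA.compl fun x hx => ?_)
  rw [mul_comm]
  exact h_le (not_le.1 (Set.notMem_ofPred_iff.1 hx)).le

end affinity

/-- **Kakutani's dichotomy**, singular case: two probability measures on a product space whose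
finite-dimensional marginals are products of measures with densities are mutually singular iff
the finite products of the Hellinger affinities of the factors get arbitrarily small. -/
theorem Measure.mutuallySingular_iff_forall_prod_affinity_lt {ι : Type*} {E : ι → Type*}
    {mE : ∀ i, MeasurableSpace (E i)} {ρ : ∀ i, Measure (E i)} [∀ i, SigmaFinite (ρ i)]
    {f g : ∀ i, E i → ℝ≥0∞} (hf : ∀ i, Measurable (f i)) (hg : ∀ i, Measurable (g i))
    [∀ i, IsProbabilityMeasure ((ρ i).withDensity (f i))]
    [∀ i, IsProbabilityMeasure ((ρ i).withDensity (g i))]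
    {μ ν : Measure (∀ i, E i)} [IsProbabilityMeasure μ] [IsProbabilityMeasure ν]
    (hμ : ∀ s : Finset ι, μ.map (fun x (i : s) => x i) =
      Measure.pi fun i : s => (ρ i).withDensity (f i))
    (hν : ∀ s : Finset ι, ν.map (fun x (i : s) => x i) =
      Measure.pi fun i : s => (ρ i).withDensity (g i)) :
    μ ⟂ₘ ν ↔ ∀ ε : ℝ≥0∞, ε ≠ 0 → ∃ s : Finset ι,
      ∏ i ∈ s, ∫⁻ x, (f i x * g i x) ^ (1 / 2 : ℝ) ∂(ρ i) < ε := by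
  have hF (s : Finset ι) : Measurable fun x : ∀ i : s, E i => ∏ i : s, f i (x i) :=
    Finset.measurable_fun_prod _ fun i _ => (hf i).comp (measurable_pi_apply i)
  have hG (s : Finset ι) : Measurable fun x : ∀ i : s, E i => ∏ i : s, g i (x i) :=
    Finset.measurable_fun_prod _ fun i _ => (hg i).comp (measurable_pi_apply i)
  have hmeas (s : Finset ι) : Measurable fun (x : ∀ i, E i) (i : s) => x i := by fun_prop
  have hprod (s : Finset ι) : ∏ i ∈ s, ∫⁻ x, (f i x * g i x) ^ (1 / 2 : ℝ) ∂(ρ i) =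
      ∫⁻ x, ((∏ i : s, f i (x i)) * ∏ i : s, g i (x i)) ^ (1 / 2 : ℝ)
        ∂(Measure.pi fun i : s => ρ i) := by
    rw [← Finset.prod_coe_sort, ← lintegral_fintype_prod_eq_prod
      (f := fun (i : s) x => (f i x * g i x) ^ (1 / 2 : ℝ))
      fun i => ((hf i).mul (hg i)).pow_const _]
    refine lintegral_congr fun x => ?_
    rw [ENNReal.prod_rpow_of_nonneg (by norm_num), Finset.prod_mul_distrib]
  simp_rw [hprod]
  have hμ' (s : Finset ι) : μ.map (fun x (i : s) => x i) =
      (Measure.pi fun i : s => ρ i).withDensity fun x => ∏ i : s, f i (x i) := by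
    rw [hμ, Measure.pi_withDensity fun i : s => hf i]
  have hν' (s : Finset ι) : ν.map (fun x (i : s) => x i) =
      (Measure.pi fun i : s => ρ i).withDensity fun x => ∏ i : s, g i (x i) := by
    rw [hν, Measure.pi_withDensity fun i : s => hg i]
  constructor
  · intro h ε hε
    obtain ⟨η, hη, hηε⟩ := ENNReal.lt_iff_exists_nnreal_btwn.1 (ENNReal.half_pos hε)
    have hdense := Measure.MeasureDense.of_generateFrom_isSetAlgebra_finite (μ := μ + ν)
      (isSetAlgebra_measurableCylinders (α := E)) generateFrom_measurableCylinders.symm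
    obtain ⟨B, hB, hAB⟩ := hdense.approx h.nullSet h.measurableSet_nullSet (by finiteness)
      ((η : ℝ) ^ 2) (pow_pos (by simpa using hη) 2)
    obtain ⟨s, S, hS, rfl⟩ := (mem_measurableCylinders B).1 hB
    have h_sq : ENNReal.ofReal ((η : ℝ) ^ 2) ^ (1 / 2 : ℝ) = η := by
      rw [ENNReal.ofReal_pow η.coe_nonneg, ENNReal.ofReal_coe_nnreal, ← ENNReal.rpow_natCast,
        ← ENNReal.rpow_mul]
      norm_num
    have hμS : μ (cylinder s S) ≤ ENNReal.ofReal ((η : ℝ) ^ 2) := by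
      refine le_trans ?_ hAB.le
      calc μ (cylinder s S) ≤ μ (h.nullSet ∪ symmDiff h.nullSet (cylinder s S)) :=
            measure_mono fun x hx => by by_cases hxA : x ∈ h.nullSet <;> simp [Set.mem_symmDiff, *]
        _ ≤ μ h.nullSet + μ (symmDiff h.nullSet (cylinder s S)) := measure_union_le _ _
        _ ≤ (μ + ν) (symmDiff h.nullSet (cylinder s S)) := by simp
    have hνS : ν (cylinder s S)ᶜ ≤ ENNReal.ofReal ((η : ℝ) ^ 2) := by
      refine le_trans ?_ hAB.le
      calc ν (cylinder s S)ᶜ ≤ ν (h.nullSetᶜ ∪ symmDiff h.nullSet (cylinder s S)) :=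
            measure_mono fun x hx => by
              by_cases hxA : x ∈ h.nullSet <;> simp_all [Set.mem_symmDiff]
        _ ≤ ν h.nullSetᶜ + ν (symmDiff h.nullSet (cylinder s S)) := measure_union_le _ _
        _ ≤ (μ + ν) (symmDiff h.nullSet (cylinder s S)) := by simp
    have hpμ : IsProbabilityMeasure
        ((Measure.pi fun i : s => ρ i).withDensity fun x => ∏ i : s, f i (x i)) :=
      hμ' s ▸ Measure.isProbabilityMeasure_map (hmeas s).aemeasurable
    have hpν : IsProbabilityMeasure
        ((Measure.pi fun i : s => ρ i).withDensity fun x => ∏ i : s, g i (x i)) :=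
      hν' s ▸ Measure.isProbabilityMeasure_map (hmeas s).aemeasurable
    refine ⟨s, (lintegral_sqrt_mul_le (hF s) (hG s) hS).trans_lt ?_⟩
    rw [← hμ', ← hν', Measure.map_apply (hmeas s) hS, Measure.map_apply (hmeas s) hS.compl]
    calc _ ≤ ENNReal.ofReal ((η : ℝ) ^ 2) ^ (1 / 2 : ℝ)
          + ENNReal.ofReal ((η : ℝ) ^ 2) ^ (1 / 2 : ℝ) :=
        add_le_add (ENNReal.rpow_le_rpow hμS (by norm_num))
          (ENNReal.rpow_le_rpow hνS (by norm_num))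
      _ < ε := by
        rw [h_sq, ← ENNReal.add_halves ε]
        exact ENNReal.add_lt_add hηε hηε
  · intro h
    refine .of_forall_exists_lt fun ε hε => ?_
    obtain ⟨s, hs⟩ := h ε hε
    obtain ⟨A, hA, hle⟩ := exists_withDensity_add_compl_le (μ := Measure.pi fun i : s => ρ i)
      (hF s) (hG s)
    rw [← hμ', ← hν', Measure.map_apply (hmeas s) hA, Measure.map_apply (hmeas s) hA.compl] at hle
    exact ⟨_, hle.trans_lt hs⟩

/-- The finite-dimensional marginals of the image of a measure under a map acting on every
coordinate. -/
theorem Measure.map_restrict_map_eq_pi_map {ι : Type*} {X Y : Type*} {mX : MeasurableSpace X}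
    {mY : MeasurableSpace Y} {μ : Measure (ι → X)} {T : X → Y} (hT : Measurable T)
    {s : Finset ι} {P : s → Measure X} [∀ i, SigmaFinite ((P i).map T)]
    (hμ : μ.map (fun x (i : s) => x i) = Measure.pi P) :
    (μ.map fun x i => T (x i)).map (fun x (i : s) => x i) =
      Measure.pi fun i => (P i).map T := by
  have hT' {κ : Type _} : Measurable fun (x : κ → X) i => T (x i) :=
    measurable_pi_lambda _ fun i => hT.comp (measurable_pi_apply i)
  rw [← Measure.pi_map_pi fun i => hT.aemeasurable, ← hμ, Measure.map_map (by fun_prop) hT',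
    Measure.map_map hT' (by fun_prop)]
  rfl

end MeasureTheory

/-- The products of the numbers `(1 + a i) ^ (-1/2)` over finite sets get arbitrarily small iff
the series of the `a i` diverges. -/
theorem forall_exists_prod_inv_sqrt_one_add_lt_iff {ι : Type*} {a : ι → ℝ} (ha : ∀ i, 0 ≤ a i) :
    (∀ ε : ℝ≥0∞, ε ≠ 0 → ∃ s : Finset ι, ∏ i ∈ s, ENNReal.ofReal (√(1 + a i))⁻¹ < ε) ↔
      ¬ Summable a := by
  have h_pos (s : Finset ι) : 0 < ∏ i ∈ s, (1 + a i) :=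
    Finset.prod_pos fun i _ => by linarith [ha i]
  have h_sum (s : Finset ι) : 1 + ∑ i ∈ s, a i ≤ ∏ i ∈ s, (1 + a i) := by
    classical
    induction s using Finset.induction_on with
    | empty => simp
    | insert i s hi ih =>
      rw [Finset.sum_insert hi, Finset.prod_insert hi]
      nlinarith [ha i, Finset.sum_nonneg fun j (_ : j ∈ s) => ha j]
  have h_prod (s : Finset ι) : ∏ i ∈ s, ENNReal.ofReal (√(1 + a i))⁻¹ =
      ENNReal.ofReal (√(∏ i ∈ s, (1 + a i)))⁻¹ := by
    rw [← ENNReal.ofReal_prod_of_nonneg fun i _ => by positivity, Finset.prod_inv_distrib,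
      Real.sqrt_prod _ fun i _ => by linarith [ha i]]
  simp_rw [h_prod]
  constructor
  · intro h hsum
    obtain ⟨s, hs⟩ := h (ENNReal.ofReal (√(Real.exp (∑' i, a i)))⁻¹)
      (by simpa using Real.exp_pos _)
    refine hs.not_ge (ENNReal.ofReal_le_ofReal (inv_anti₀ (Real.sqrt_pos.2 (h_pos s)) ?_))
    exact Real.sqrt_le_sqrt ((Real.prod_one_add_le_exp_sum s ha).trans
      (Real.exp_le_exp.2 (hsum.sum_le_tsum s fun i _ => ha i)))
  · intro h ε hε
    by_contra! hle
    obtain ⟨η, hη, hηε⟩ := ENNReal.lt_iff_exists_nnreal_btwn.1 hε.bot_lt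
    have hη : 0 < (η : ℝ) := by simpa using hη
    refine h (summable_of_sum_le (c := (η⁻¹ : ℝ) ^ 2) ha fun s => ?_)
    have h1 : (η : ℝ) ≤ (√(∏ i ∈ s, (1 + a i)))⁻¹ := by
      rw [← ENNReal.ofReal_le_ofReal_iff (by positivity), ENNReal.ofReal_coe_nnreal]
      exact hηε.le.trans (hle s)
    have h2 : √(∏ i ∈ s, (1 + a i)) ≤ (η : ℝ)⁻¹ := by
      rwa [le_inv_comm₀ (Real.sqrt_pos.2 (h_pos s)) hη]
    have h3 : ∏ i ∈ s, (1 + a i) ≤ ((η : ℝ)⁻¹) ^ 2 := (Real.sqrt_le_left (by positivity)).1 h2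
    linarith [h_sum s]

/-- The Gaussian integral of a positive definite binary quadratic form. -/
theorem lintegral_exp_neg_binary_quadratic {α β γ : ℝ} (hα : 0 < α) (hD : 0 < 4 * α * γ - β ^ 2) :
    ∫⁻ y : Fin 2 → ℝ, ENNReal.ofReal (Real.exp (-(α * y 0 ^ 2 + β * (y 0 * y 1) + γ * y 1 ^ 2))) =
      ENNReal.ofReal (2 * Real.pi / √(4 * α * γ - β ^ 2)) := by
  have h1 {c : ℝ} (hc : 0 < c) :
      ∫⁻ x : ℝ, ENNReal.ofReal (Real.exp (-c * x ^ 2)) = ENNReal.ofReal √(Real.pi / c) := by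
    rw [← integral_gaussian, ofReal_integral_eq_lintegral_ofReal (integrable_exp_neg_mul_sq hc)
      (Filter.Eventually.of_forall fun x => (Real.exp_pos _).le)]
  set δ := γ - β ^ 2 / (4 * α) with hδ
  have hδα : 4 * α * γ - β ^ 2 = 4 * α * δ := by rw [hδ]; field_simp
  have hδ_pos : 0 < δ := by
    rw [hδα] at hD
    exact pos_of_mul_pos_right hD (by positivity)
  have h2 (x y : ℝ) : ENNReal.ofReal (Real.exp (-(α * x ^ 2 + β * (x * y) + γ * y ^ 2))) =
      ENNReal.ofReal (Real.exp (-α * (x + β / (2 * α) * y) ^ 2)) *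
        ENNReal.ofReal (Real.exp (-δ * y ^ 2)) := by
    rw [← ENNReal.ofReal_mul (Real.exp_pos _).le, ← Real.exp_add, hδ]
    congr 2
    field_simp
    ring
  have h3 := (volume_preserving_finTwoArrow ℝ).lintegral_comp_emb
    (MeasurableEquiv.measurableEmbedding _) fun p : ℝ × ℝ =>
      ENNReal.ofReal (Real.exp (-(α * p.1 ^ 2 + β * (p.1 * p.2) + γ * p.2 ^ 2)))
  refine h3.trans ?_
  rw [Measure.volume_eq_prod, lintegral_prod_symm' _ (by fun_prop)]
  simp_rw [h2]
  have h4 (y : ℝ) : ∫⁻ x : ℝ, ENNReal.ofReal (Real.exp (-α * (x + β / (2 * α) * y) ^ 2)) *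
      ENNReal.ofReal (Real.exp (-δ * y ^ 2)) =
      ENNReal.ofReal √(Real.pi / α) * ENNReal.ofReal (Real.exp (-δ * y ^ 2)) := by
    rw [lintegral_mul_const _ (by fun_prop), lintegral_add_right_eq_self
      (fun x => ENNReal.ofReal (Real.exp (-α * x ^ 2))), h1 hα]
  simp_rw [h4]
  rw [lintegral_const_mul _ (by fun_prop), h1 hδ_pos, ← ENNReal.ofReal_mul (by positivity),
    ← Real.sqrt_mul (by positivity), hδα]
  congr 1
  rw [Real.sqrt_eq_iff_eq_sq (by positivity) (by positivity), div_pow, Real.sq_sqrt (by positivity)]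
  field_simp
  norm_num

section linear

variable {ι : Type*} [Fintype ι] [DecidableEq ι] {M : Matrix ι ι ℝ}

theorem lintegral_comp_mulVec (hM : M.det ≠ 0) {h : (ι → ℝ) → ℝ≥0∞} (hh : Measurable h) :
    ∫⁻ y, h (M *ᵥ y) = ENNReal.ofReal |M.det⁻¹| * ∫⁻ x, h x := by
  rw [← smul_eq_mul, ← lintegral_smul_measure, ← Real.map_matrix_volume_pi_eq_smul_volume_pi hM,
    lintegral_map hh (by fun_prop)]
  rfl

theorem map_mulVec_withDensity (hM : M.det ≠ 0) {f : (ι → ℝ) → ℝ≥0∞} (hf : Measurable f) :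
    (volume.withDensity f).map (M *ᵥ ·) =
      volume.withDensity fun x => ENNReal.ofReal |M.det⁻¹| * f (M⁻¹ *ᵥ x) := by
  have hmeas (N : Matrix ι ι ℝ) : Measurable (N *ᵥ · : (ι → ℝ) → ι → ℝ) :=
    (Continuous.matrix_mulVec continuous_const continuous_id).measurable
  ext s hs
  have hfM : Measurable fun x => f (M⁻¹ *ᵥ x) := hf.comp (hmeas M⁻¹)
  have h := lintegral_comp_mulVec hM (hfM.indicator hs)
  rw [Measure.map_apply (hmeas M) hs, withDensity_apply _ (hmeas M hs), withDensity_apply _ hs,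
    lintegral_const_mul _ hfM, ← lintegral_indicator (hmeas M hs), ← lintegral_indicator hs]
  refine (lintegral_congr fun y => ?_).trans h
  by_cases hy : M *ᵥ y ∈ s
  · simp [Set.indicator, hy, nonsing_inv_mul _ hM.isUnit]
  · simp [Set.indicator, hy]

end linear

/-- The density of the product of the centered Gaussian measures with variances `1 / (2 * b₁)` and
`1 / (2 * b₂)`. -/
noncomputable def gaussianPairDensity (b₁ b₂ : ℝ) (x : Fin 2 → ℝ) : ℝ≥0∞ :=
  ENNReal.ofReal (√(b₁ * b₂) / Real.pi * Real.exp (-(b₁ * x 0 ^ 2 + b₂ * x 1 ^ 2)))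

theorem measurable_gaussianPairDensity (b₁ b₂ : ℝ) : Measurable (gaussianPairDensity b₁ b₂) := by
  unfold gaussianPairDensity
  fun_prop

theorem gaussianPDFReal_one_div_two_mul {b : ℝ} (hb : 0 < b) (x : ℝ) :
    gaussianPDFReal 0 (Real.toNNReal (1 / (2 * b))) x =
      √(b / Real.pi) * Real.exp (-(b * x ^ 2)) := by
  rw [gaussianPDFReal, Real.coe_toNNReal _ (by positivity), ← Real.sqrt_inv]
  congr 2
  · field_simp
  · field_simp
    ring

theorem withDensity_gaussianPairDensity {b₁ b₂ : ℝ} (hb₁ : 0 < b₁) (hb₂ : 0 < b₂) :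
    volume.withDensity (gaussianPairDensity b₁ b₂) =
      Measure.pi fun r : Fin 2 => gaussianReal 0 (Real.toNNReal (1 / (2 * ![b₁, b₂] r))) := by
  have hb (r : Fin 2) : Real.toNNReal (1 / (2 * ![b₁, b₂] r)) ≠ 0 := by
    fin_cases r <;> simpa
  have : ∀ r : Fin 2, SigmaFinite ((volume : Measure ℝ).withDensity
      (gaussianPDF 0 (Real.toNNReal (1 / (2 * ![b₁, b₂] r))))) := fun r => by
    rw [← gaussianReal_of_var_ne_zero 0 (hb r)]
    infer_instance
  simp_rw [gaussianReal_of_var_ne_zero 0 (hb _)]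
  rw [Measure.pi_withDensity fun r => measurable_gaussianPDF _ _]
  change volume.withDensity _ = volume.withDensity _
  congr 1
  ext x
  simp only [Fin.prod_univ_two, gaussianPDF, cons_val_zero, cons_val_one,
    gaussianPDFReal_one_div_two_mul hb₁, gaussianPDFReal_one_div_two_mul hb₂]
  rw [← ENNReal.ofReal_mul (by positivity), gaussianPairDensity]
  congr 1
  rw [mul_mul_mul_comm, ← Real.exp_add, ← Real.sqrt_mul (by positivity), neg_add]
  congr 1
  rw [div_mul_div_comm, ← sq, Real.sqrt_div' _ (by positivity), Real.sqrt_sq Real.pi_pos.le]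

/-- The Hellinger affinity of a centered Gaussian measure on `ℝ²` with its image under a linear
map. -/
theorem lintegral_sqrt_gaussianPairDensity_mul {b₁ b₂ : ℝ} (hb₁ : 0 < b₁) (hb₂ : 0 < b₂)
    {t : Matrix (Fin 2) (Fin 2) ℝ} (ht : t.det ≠ 0) :
    ∫⁻ x, (gaussianPairDensity b₁ b₂ x *
        (ENNReal.ofReal |t.det⁻¹| * gaussianPairDensity b₁ b₂ (t⁻¹ *ᵥ x))) ^ (1 / 2 : ℝ) =
      ENNReal.ofReal (√((1 + t.det ^ 2 + t 0 0 ^ 2 + t 1 1 ^ 2 + t 0 1 ^ 2 * (b₁ / b₂) +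
        t 1 0 ^ 2 * (b₂ / b₁)) / (4 * |t.det|)))⁻¹ := by
  set d := |t.det| with hd_def
  have hd : 0 < d := abs_pos.2 ht
  have hmeas : Measurable (t⁻¹ *ᵥ · : (Fin 2 → ℝ) → Fin 2 → ℝ) :=
    (Continuous.matrix_mulVec continuous_const continuous_id).measurable
  have hf := measurable_gaussianPairDensity b₁ b₂
  have h := lintegral_comp_mulVec ht
    ((hf.mul ((hf.comp hmeas).const_mul (ENNReal.ofReal |t.det⁻¹|))).pow_const (1 / 2 : ℝ))
  simp only [Pi.mul_apply, Function.comp_apply, mulVec_mulVec, nonsing_inv_mul _ ht.isUnit,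
    one_mulVec] at h
  set I := ∫⁻ x, (gaussianPairDensity b₁ b₂ x *
    (ENNReal.ofReal |t.det⁻¹| * gaussianPairDensity b₁ b₂ (t⁻¹ *ᵥ x))) ^ (1 / 2 : ℝ)
  have hI : I = ENNReal.ofReal d * (ENNReal.ofReal |t.det⁻¹| * I) := by
    rw [← mul_assoc, ← ENNReal.ofReal_mul hd.le, abs_inv, mul_inv_cancel₀ hd.ne',
      ENNReal.ofReal_one, one_mul]
  set α := (b₁ * (1 + t 0 0 ^ 2) + b₂ * t 1 0 ^ 2) / 2 with hα
  set β := b₁ * (t 0 0 * t 0 1) + b₂ * (t 1 0 * t 1 1) with hβ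
  set γ := (b₁ * t 0 1 ^ 2 + b₂ * (1 + t 1 1 ^ 2)) / 2 with hγ
  set N := 1 + t.det ^ 2 + t 0 0 ^ 2 + t 1 1 ^ 2 + t 0 1 ^ 2 * (b₁ / b₂) +
    t 1 0 ^ 2 * (b₂ / b₁) with hN
  have hN_pos : 0 < N := by positivity
  have hD : 4 * α * γ - β ^ 2 = b₁ * b₂ * N := by
    rw [hα, hβ, hγ, hN, det_fin_two]
    field_simp
    ring
  have h_integrand (y : Fin 2 → ℝ) : (gaussianPairDensity b₁ b₂ (t *ᵥ y) *
      (ENNReal.ofReal |t.det⁻¹| * gaussianPairDensity b₁ b₂ y)) ^ (1 / 2 : ℝ) =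
      ENNReal.ofReal (√d⁻¹ * (√(b₁ * b₂) / Real.pi)) *
        ENNReal.ofReal (Real.exp (-(α * y 0 ^ 2 + β * (y 0 * y 1) + γ * y 1 ^ 2))) := by
    unfold gaussianPairDensity
    rw [← ENNReal.ofReal_mul (by positivity), ← ENNReal.ofReal_mul (by positivity),
      ← ENNReal.ofReal_mul (by positivity), ENNReal.ofReal_rpow_of_nonneg (by positivity)
      (by norm_num), ← Real.sqrt_eq_rpow]
    congr 1
    rw [Real.sqrt_eq_iff_eq_sq (by positivity) (by positivity), mul_pow, mul_pow,
      Real.sq_sqrt (by positivity), ← Real.exp_nat_mul, abs_inv, ← hd_def]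
    rw [show ∀ k u v : ℝ, k * Real.exp u * (d⁻¹ * (k * Real.exp v)) =
      d⁻¹ * k ^ 2 * Real.exp (u + v) from fun k u v => by rw [Real.exp_add]; ring]
    congr 2
    simp only [mulVec, dotProduct, Fin.sum_univ_two, hα, hβ, hγ]
    push_cast
    ring
  rw [hI, ← h]
  simp_rw [h_integrand]
  rw [lintegral_const_mul _ (by fun_prop), lintegral_exp_neg_binary_quadratic (by positivity)
    (by rw [hD]; positivity), hD, ← ENNReal.ofReal_mul (by positivity),
    ← ENNReal.ofReal_mul hd.le]
  congr 1
  rw [Real.sqrt_mul (by positivity) N, Real.sqrt_div hN_pos.le, Real.sqrt_mul (by norm_num) d,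
    show (4 : ℝ) = 2 ^ 2 by norm_num, Real.sqrt_sq (by norm_num), Real.sqrt_inv]
  have hsq := Real.sq_sqrt hd.le
  have : 0 < √d := Real.sqrt_pos.2 hd
  have : 0 < √(b₁ * b₂) := by positivity
  have : 0 < √N := by positivity
  field_simp
  linear_combination -hsq

/-- A linear map acting on every coordinate of a product of centered Gaussian measures on `ℝ²`
produces a singular measure iff the series of the defects of the Hellinger affinities diverges. -/
theorem mutuallySingular_map_mulVec_iff
    {b₁ b₂ : ℤ → ℝ} (hb₁ : ∀ n, 0 < b₁ n) (hb₂ : ∀ n, 0 < b₂ n)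
    {μ : Measure (ℤ → Fin 2 → ℝ)} [IsProbabilityMeasure μ]
    (hμ : ∀ s : Finset ℤ, μ.map (fun x (i : s) => x i) =
      Measure.pi fun i : s => Measure.pi fun r : Fin 2 =>
        gaussianReal 0 (Real.toNNReal (1 / (2 * ![b₁ i, b₂ i] r))))
    {t : Matrix (Fin 2) (Fin 2) ℝ} (ht : t.det ≠ 0) {S : ℤ → ℝ} (hS : ∀ n, 0 ≤ S n)
    (hS_eq : ∀ n, S n = 1 + t.det ^ 2 + t 0 0 ^ 2 + t 1 1 ^ 2 + t 0 1 ^ 2 * (b₁ n / b₂ n) +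
        t 1 0 ^ 2 * (b₂ n / b₁ n) - 4 * |t.det|) :
    (μ.map fun x n => t *ᵥ x n) ⟂ₘ μ ↔ ¬ Summable S := by
  have hmeas : Measurable (t *ᵥ · : (Fin 2 → ℝ) → Fin 2 → ℝ) :=
    (Continuous.matrix_mulVec continuous_const continuous_id).measurable
  have hmeas' : Measurable (t⁻¹ *ᵥ · : (Fin 2 → ℝ) → Fin 2 → ℝ) :=
    (Continuous.matrix_mulVec continuous_const continuous_id).measurable
  have hL : Measurable fun (x : ℤ → Fin 2 → ℝ) n => t *ᵥ x n :=
    measurable_pi_lambda _ fun n => hmeas.comp (measurable_pi_apply n)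
  have hf (n : ℤ) := measurable_gaussianPairDensity (b₁ n) (b₂ n)
  have hg (n : ℤ) : Measurable fun x =>
      ENNReal.ofReal |t.det⁻¹| * gaussianPairDensity (b₁ n) (b₂ n) (t⁻¹ *ᵥ x) :=
    ((hf n).comp hmeas').const_mul _
  have hpf (n : ℤ) : IsProbabilityMeasure
      ((volume : Measure (Fin 2 → ℝ)).withDensity (gaussianPairDensity (b₁ n) (b₂ n))) := by
    rw [withDensity_gaussianPairDensity (hb₁ n) (hb₂ n)]
    infer_instance
  have hpg (n : ℤ) : IsProbabilityMeasure ((volume : Measure (Fin 2 → ℝ)).withDensity fun x =>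
      ENNReal.ofReal |t.det⁻¹| * gaussianPairDensity (b₁ n) (b₂ n) (t⁻¹ *ᵥ x)) := by
    rw [← map_mulVec_withDensity ht (hf n)]
    exact Measure.isProbabilityMeasure_map hmeas.aemeasurable
  have : IsProbabilityMeasure (μ.map fun x n => t *ᵥ x n) :=
    Measure.isProbabilityMeasure_map hL.aemeasurable
  have hμ' (s : Finset ℤ) : μ.map (fun x (i : s) => x i) = Measure.pi fun i : s =>
      (volume : Measure (Fin 2 → ℝ)).withDensity (gaussianPairDensity (b₁ i) (b₂ i)) := by
    simp_rw [hμ, withDensity_gaussianPairDensity (hb₁ _) (hb₂ _)]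
  have hν (s : Finset ℤ) : (μ.map fun x n => t *ᵥ x n).map (fun x (i : s) => x i) =
      Measure.pi fun i : s => (volume : Measure (Fin 2 → ℝ)).withDensity fun x =>
        ENNReal.ofReal |t.det⁻¹| * gaussianPairDensity (b₁ i) (b₂ i) (t⁻¹ *ᵥ x) := by
    have (i : s) : IsProbabilityMeasure (((volume : Measure (Fin 2 → ℝ)).withDensity
        (gaussianPairDensity (b₁ i) (b₂ i))).map (t *ᵥ ·)) :=
      Measure.isProbabilityMeasure_map hmeas.aemeasurable
    simp_rw [← map_mulVec_withDensity ht (hf _)]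
    exact Measure.map_restrict_map_eq_pi_map hmeas (hμ' s)
  rw [Measure.MutuallySingular.comm]
  refine (Measure.mutuallySingular_iff_forall_prod_affinity_lt (ρ := fun _ => volume)
    (f := fun n => gaussianPairDensity (b₁ n) (b₂ n))
    (g := fun n x => ENNReal.ofReal |t.det⁻¹| * gaussianPairDensity (b₁ n) (b₂ n) (t⁻¹ *ᵥ x))
    hf hg hμ' hν).trans ?_
  have hc : 0 < 4 * |t.det| := by positivity
  have h_aff (n : ℤ) : ∫⁻ x, (gaussianPairDensity (b₁ n) (b₂ n) x * (ENNReal.ofReal |t.det⁻¹| *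
      gaussianPairDensity (b₁ n) (b₂ n) (t⁻¹ *ᵥ x))) ^ (1 / 2 : ℝ) =
      ENNReal.ofReal (√(1 + S n / (4 * |t.det|)))⁻¹ := by
    rw [lintegral_sqrt_gaussianPairDensity_mul (hb₁ n) (hb₂ n) ht, hS_eq]
    congr 3
    field_simp
    ring
  simp_rw [h_aff]
  rw [forall_exists_prod_inv_sqrt_one_add_lt_iff fun n => div_nonneg (hS n) hc.le,
    summable_div_const_iff hc.ne']

/-- For the product over `n ∈ ℤ` of two-dimensional centered Gaussian measures with
variances `1/(2b₁(n))`, `1/(2b₂(n))` (characterized by its finite-dimensional marginals)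
and an invertible `2×2` matrix `t` acting on every coordinate, `μ^{L_t} ⟂ μ` is
characterized by the divergence of the corresponding series, according to the sign of
`det t`. -/
theorem matrix_action_singular_iff
    (b₁ b₂ : ℤ → ℝ) (hb₁ : ∀ n, 0 < b₁ n) (hb₂ : ∀ n, 0 < b₂ n)
    (μ : Measure (ℤ → Fin 2 → ℝ)) [IsProbabilityMeasure μ]
    (hμ : ∀ s : Finset ℤ, μ.map (fun x (i : s) => x i) =
      Measure.pi fun i : s => Measure.pi fun r : Fin 2 =>
        gaussianReal 0 (Real.toNNReal (1 / (2 * ![b₁ i, b₂ i] r))))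
    (t : Matrix (Fin 2) (Fin 2) ℝ) (ht : IsUnit t.det) :
    (0 < t.det →
      ((μ.map fun x n => t.mulVec (x n)) ⟂ₘ μ ↔
        ¬ Summable fun n : ℤ =>
          (1 - |t.det|) ^ 2 + (t 0 0 - t 1 1) ^ 2 +
            (t 0 1 * Real.sqrt (b₁ n / b₂ n) + t 1 0 * Real.sqrt (b₂ n / b₁ n)) ^ 2)) ∧
    (t.det < 0 →
      ((μ.map fun x n => t.mulVec (x n)) ⟂ₘ μ ↔
        ¬ Summable fun n : ℤ =>
          (1 - |t.det|) ^ 2 + (t 0 0 + t 1 1) ^ 2 +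
            (t 0 1 * Real.sqrt (b₁ n / b₂ n) - t 1 0 * Real.sqrt (b₂ n / b₁ n)) ^ 2)) := by
  have h_sq (n : ℤ) : √(b₁ n / b₂ n) ^ 2 = b₁ n / b₂ n ∧ √(b₂ n / b₁ n) ^ 2 = b₂ n / b₁ n ∧
      √(b₁ n / b₂ n) * √(b₂ n / b₁ n) = 1 := by
    have h₁ := hb₁ n
    have h₂ := hb₂ n
    refine ⟨Real.sq_sqrt (by positivity), Real.sq_sqrt (by positivity), ?_⟩
    rw [← Real.sqrt_mul (by positivity), div_mul_div_cancel₀ h₂.ne', div_self h₁.ne',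
      Real.sqrt_one]
  have hdet := det_fin_two t
  refine ⟨fun hpos => ?_, fun hneg => ?_⟩
  · refine mutuallySingular_map_mulVec_iff hb₁ hb₂ hμ hpos.ne' (fun n => by positivity) fun n => ?_
    obtain ⟨h₁, h₂, h₁₂⟩ := h_sq n
    rw [abs_of_pos hpos]
    linear_combination t 0 1 ^ 2 * h₁ + t 1 0 ^ 2 * h₂ + 2 * t 0 1 * t 1 0 * h₁₂ + 2 * hdet
  · refine mutuallySingular_map_mulVec_iff hb₁ hb₂ hμ hneg.ne (fun n => by positivity) fun n => ?_
    obtain ⟨h₁, h₂, h₁₂⟩ := h_sq n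
    rw [abs_of_neg hneg]
    linear_combination t 0 1 ^ 2 * h₁ + t 1 0 ^ 2 * h₂ - 2 * t 0 1 * t 1 0 * h₁₂ - 2 * hdet
end
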